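/- For every even natural number k and for n = 2g+1 or n = 2g+2, the moment over monic irreducible polynomials satisfies (1/π_A(n)) Σ_{P monic irreducible, deg P = n} L(1/2, χ_P)^k ≫_k n^{k(k+1)/2} as n → ∞, where π_A(n) is the number of monic irreducibles of degree n. -/

import Mathlib

open Polynomial Filter Asymptotics
open scoped Classical

variable {Fq : Type} [Field Fq] [Fintype Fq]

/-- Norm of a polynomial: `|f| = q^(deg f)` for `f ≠ 0`, and `|0| = 0`. -/
noncomputable def pnorm (f : Polynomial Fq) : ℝ :=
  if f = 0 then 0 else (Fintype.card Fq : ℝ) ^ f.natDegree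

/-- Monic polynomials of degree `n`. -/
def monicDeg (Fq : Type) [Field Fq] (n : ℕ) : Set (Polynomial Fq) :=
  {f | f.Monic ∧ f.natDegree = n}

/-- `H_{2g+1}`: monic square-free polynomials of degree `2g+1`. -/
def Hset (Fq : Type) [Field Fq] (g : ℕ) : Set (Polynomial Fq) :=
  {D | D.Monic ∧ Squarefree D ∧ D.natDegree = 2 * g + 1}

/-- Quadratic residue symbol `(D/P)` for an irreducible `P`. -/
noncomputable def quadCharP (D P : Polynomial Fq) : ℤ :=
  if P ∣ D then 0 else if ∃ x : Polynomial Fq, P ∣ (x ^ 2 - D) then 1 else -1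

/-- Jacobi-type quadratic residue symbol `(D/n)`, extended multiplicatively over
irreducible factors of `n`. -/
noncomputable def jacobi (D n : Polynomial Fq) : ℤ :=
  ((UniqueFactorizationMonoid.factors n).map (quadCharP D)).prod

/-- The quadratic Dirichlet L-function `L(s, χ_D)` as a finite sum
`Σ_{n=0}^{deg D - 1} (Σ_{f monic, deg f = n} χ_D(f)) q^{-ns}`. -/
noncomputable def Lfun (D : Polynomial Fq) (s : ℂ) : ℂ :=
  ∑ n ∈ Finset.range D.natDegree,
    (∑ᶠ f ∈ monicDeg Fq n, (jacobi D f : ℂ)) * (Fintype.card Fq : ℂ) ^ (-(n : ℂ) * s)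

/-- The central value `L(1/2, χ_D)` as a real number. -/
noncomputable def LhalfR (D : Polynomial Fq) : ℝ :=
  ∑ n ∈ Finset.range D.natDegree,
    (∑ᶠ f ∈ monicDeg Fq n, (jacobi D f : ℝ)) * (Real.sqrt (Fintype.card Fq))⁻¹ ^ n

/-- `a_m = Π_{P | m} |P|/(|P|+1)` over monic irreducible divisors `P` of `m`. -/
noncomputable def am (m : Polynomial Fq) : ℝ :=
  ∏ᶠ (P : Polynomial Fq) (_ : P.Monic ∧ Irreducible P ∧ P ∣ m), pnorm P / (pnorm P + 1)

/-- `d_k(m)`: the number of ordered `k`-tuples of monic polynomials with product `m`. -/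
noncomputable def dfold (k : ℕ) (m : Polynomial Fq) : ℕ :=
  Nat.card {t : Fin k → Polynomial Fq // (∀ i, (t i).Monic) ∧ ∏ i, t i = m}

/-- Möbius function on `F_q[T]`. -/
noncomputable def moebiusP (f : Polynomial Fq) : ℤ :=
  if Squarefree f then (-1) ^ (UniqueFactorizationMonoid.factors f).card else 0

/-- The Dirichlet polynomial `A(D) = Σ_{n monic, deg n ≤ 4g/(15k)} χ_D(n)/√|n|`. -/
noncomputable def AD (k g : ℕ) (D : Polynomial Fq) : ℝ :=
  ∑ᶠ n ∈ {n : Polynomial Fq | n.Monic ∧ n.natDegree ≤ 4 * g / (15 * k)},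
    (jacobi D n : ℝ) / Real.sqrt (pnorm n)

set_option linter.unusedSectionVars false

/-- The residue field of an irreducible polynomial is finite. -/
noncomputable instance adjoinRootFintype (P : Fq[X]) [hP : Fact (Irreducible P)] :
    Fintype (AdjoinRoot P) := by
  have : NeZero P := ⟨hP.out.ne_zero⟩
  have : Module.Finite Fq (AdjoinRoot P) := (AdjoinRoot.powerBasis hP.out.ne_zero).finite
  have := Module.finite_of_finite Fq (M := AdjoinRoot P)
  exact Fintype.ofFinite _

lemma card_adjoinRoot (P : Fq[X]) [hP : Fact (Irreducible P)] :
    Fintype.card (AdjoinRoot P) = Fintype.card Fq ^ P.natDegree := by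
  have : Module.Finite Fq (AdjoinRoot P) := (AdjoinRoot.powerBasis hP.out.ne_zero).finite
  rw [Module.card_eq_pow_finrank (K := Fq)]
  congr 1
  exact finrank_quotient_span_eq_natDegree

lemma ringChar_adjoinRoot (P : Fq[X]) [hP : Fact (Irreducible P)] (h2 : ringChar Fq ≠ 2) :
    ringChar (AdjoinRoot P) ≠ 2 := by
  rwa [← Algebra.ringChar_eq Fq (AdjoinRoot P)]

lemma quadCharP_eq_quadraticChar (P : Fq[X]) [hP : Fact (Irreducible P)] (f : Fq[X]) :
    quadCharP f P = quadraticChar (AdjoinRoot P) (AdjoinRoot.mk P f) := by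
  unfold quadCharP
  rw [quadraticChar_apply, quadraticCharFun]
  simp only [AdjoinRoot.mk_eq_zero]
  congr 1
  congr 1
  apply propext
  constructor
  · rintro ⟨x, hx⟩
    refine ⟨AdjoinRoot.mk P x, ?_⟩
    rw [← map_mul, eq_comm, AdjoinRoot.mk_eq_mk, ← pow_two]
    exact hx
  · rintro ⟨y, hy⟩
    obtain ⟨x, rfl⟩ := AdjoinRoot.mk_surjective y
    refine ⟨x, ?_⟩
    rw [← map_mul, eq_comm, AdjoinRoot.mk_eq_mk, ← pow_two] at hy
    exact hy

lemma quadCharP_mul {P : Fq[X]} (hP : Irreducible P) (f g : Fq[X]) :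
    quadCharP (f * g) P = quadCharP f P * quadCharP g P := by
  have := Fact.mk hP
  simp only [quadCharP_eq_quadraticChar, map_mul]

lemma quadCharP_one {P : Fq[X]} (hP : Irreducible P) : quadCharP 1 P = 1 := by
  have := Fact.mk hP
  simp [quadCharP_eq_quadraticChar]

lemma quadCharP_pow {P : Fq[X]} (hP : Irreducible P) (f : Fq[X]) (k : ℕ) :
    quadCharP (f ^ k) P = quadCharP f P ^ k := by
  have := Fact.mk hP
  simp only [quadCharP_eq_quadraticChar, map_pow]

lemma quadCharP_prod {P : Fq[X]} (hP : Irreducible P) {ι : Type*} (s : Finset ι) (f : ι → Fq[X]) :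
    quadCharP (∏ i ∈ s, f i) P = ∏ i ∈ s, quadCharP (f i) P := by
  have := Fact.mk hP
  simp only [quadCharP_eq_quadraticChar, map_prod]

lemma quadCharP_eq_zero_iff {P : Fq[X]} (hP : Irreducible P) (f : Fq[X]) :
    quadCharP f P = 0 ↔ P ∣ f := by
  have := Fact.mk hP
  rw [quadCharP_eq_quadraticChar, quadraticChar_eq_zero_iff, AdjoinRoot.mk_eq_zero]

lemma quadCharP_sq_eq_one {P : Fq[X]} (hP : Irreducible P) {f : Fq[X]} (h : ¬ P ∣ f) :
    quadCharP f P ^ 2 = 1 := by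
  have := Fact.mk hP
  rw [quadCharP_eq_quadraticChar]
  apply quadraticChar_sq_one
  simpa using h

lemma quadCharP_eq_one_or {P : Fq[X]} (hP : Irreducible P) {f : Fq[X]} (h : ¬ P ∣ f) :
    quadCharP f P = 1 ∨ quadCharP f P = -1 :=
  mul_self_eq_one_iff.mp (by rw [← pow_two]; exact quadCharP_sq_eq_one hP h)

/-- Euler's criterion. -/
lemma dvd_pow_sub_quadCharP {P : Fq[X]} (hP : Irreducible P) (h2 : ringChar Fq ≠ 2) (f : Fq[X]) :
    P ∣ f ^ (Fintype.card Fq ^ P.natDegree / 2) - ((quadCharP f P : ℤ) : Fq[X]) := by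
  have := Fact.mk hP
  rw [quadCharP_eq_quadraticChar, ← AdjoinRoot.mk_eq_mk, map_pow, map_intCast,
    quadraticChar_eq_pow_of_char_ne_two' (ringChar_adjoinRoot P h2), card_adjoinRoot]

lemma quadCharP_C {P : Fq[X]} (hP : Irreducible P) (h2 : ringChar Fq ≠ 2) (c : Fq) :
    quadCharP (C c) P = quadraticChar Fq c ^ P.natDegree := by
  have := Fact.mk hP
  have h2' := ringChar_adjoinRoot P h2
  have hodd := FiniteField.odd_card_of_char_ne_two h2
  have hd := hP.natDegree_pos
  by_cases hc : c = 0
  · subst hc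
    have : quadCharP (C (0 : Fq)) P = 0 := by rw [quadCharP_eq_zero_iff hP]; simp
    rw [this]
    simp [hd.ne']
  set q := Fintype.card Fq with hq
  have h1 : q ^ P.natDegree / 2 = q / 2 * ∑ i ∈ Finset.range P.natDegree, q ^ i := by
    have h3 := Nat.geomSum_eq (m := q) Fintype.one_lt_card P.natDegree
    have h4 := geom_sum_mul_add (q - 1) P.natDegree
    have h6 : q - 1 + 1 = q := by omega
    rw [h6] at h4
    have h5 : q - 1 = 2 * (q / 2) := by omega
    rw [h5] at h4
    generalize (∑ i ∈ Finset.range P.natDegree, q ^ i) = S at *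
    rw [← h4]
    have : S * (2 * (q / 2)) = 2 * (q / 2 * S) := by ring
    omega
  have key : ((quadraticChar (AdjoinRoot P) (AdjoinRoot.mk P (C c)) : ℤ) : AdjoinRoot P)
      = ((quadraticChar Fq c ^ P.natDegree : ℤ) : AdjoinRoot P) := by
    rw [quadraticChar_eq_pow_of_char_ne_two' h2', card_adjoinRoot, ← hq, h1, pow_mul]
    have h7 : (AdjoinRoot.mk P (C c)) ^ (q / 2) = ((quadraticChar Fq c : ℤ) : AdjoinRoot P) := by
      have := quadraticChar_eq_pow_of_char_ne_two' h2 c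
      have h8 := congrArg (fun z => AdjoinRoot.mk P (C z)) this
      simp only [map_pow, map_intCast] at h8
      rw [h8]
    rw [h7]
    rcases quadraticChar_dichotomy hc with h | h
    · simp [h]
    · rw [h]
      push_cast
      rw [neg_one_pow_eq_pow_mod_two, neg_one_pow_eq_pow_mod_two (n := P.natDegree)]
      congr 1
      rw [Finset.sum_nat_mod]
      have : ∀ i, q ^ i % 2 = 1 := fun i => Nat.odd_iff.mp ((Nat.odd_iff.mpr hodd).pow)
      simp [this]
  rw [quadCharP_eq_quadraticChar]
  have hc' : AdjoinRoot.mk P (C c) ≠ 0 := by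
    simpa using hc
  have hne : (1 : AdjoinRoot P) ≠ -1 := by
    exact (Ring.neg_one_ne_one_of_char_ne_two h2').symm
  rcases quadraticChar_dichotomy hc' with h | h <;>
  rcases mul_self_eq_one_iff.mp (show (quadraticChar Fq c ^ P.natDegree) *
      (quadraticChar Fq c ^ P.natDegree) = 1 by
    rw [← pow_two, ← pow_mul, mul_comm, pow_mul, quadraticChar_sq_one hc, one_pow]) with h' | h' <;>
  rw [h, h'] at key ⊢ <;> push_cast at key
  · exact absurd key hne
  · exact absurd key.symm hne

lemma norm_mk_eq_resultant {P : Fq[X]} (hP : Irreducible P) (hm : P.Monic) (f : Fq[X]) :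
    Algebra.norm Fq (AdjoinRoot.mk P f) = resultant P f := by
  have := Fact.mk hP
  have : Module.Finite Fq (AdjoinRoot P) := (AdjoinRoot.powerBasis hP.ne_zero).finite
  let Ω := AlgebraicClosure Fq
  apply (algebraMap Fq Ω).injective
  rw [Algebra.norm_eq_prod_embeddings, ← resultant_map_map,
    ← natDegree_map (f := algebraMap Fq Ω) (p := P),
    resultant_eq_prod_eval _ _ _ natDegree_map_le (IsAlgClosed.splits _),
    (hm.map _).leadingCoeff, one_pow, one_mul]
  have hsep : (P.map (algebraMap Fq Ω)).roots.Nodup :=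
    nodup_roots ((PerfectField.separable_of_irreducible hP).map)
  have hfin : (P.map (algebraMap Fq Ω)).roots = (P.map (algebraMap Fq Ω)).roots.toFinset.val := by
    rw [Multiset.toFinset_val, hsep.dedup]
  rw [hfin, Finset.prod_map_val]
  refine Finset.prod_bij (fun σ _ => σ (AdjoinRoot.root P)) ?_ ?_ ?_ ?_
  · intro σ _
    rw [Multiset.mem_toFinset, mem_roots (hm.map _).ne_zero, IsRoot.def, eval_map_algebraMap,
      aeval_algHom_apply, AdjoinRoot.aeval_eq, AdjoinRoot.mk_self, map_zero]
  · intro σ _ τ _ h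
    exact AdjoinRoot.algHom_ext h
  · intro b hb
    rw [Multiset.mem_toFinset, mem_roots (hm.map _).ne_zero, IsRoot.def, eval_map_algebraMap] at hb
    exact ⟨AdjoinRoot.liftAlgHom P (Algebra.ofId Fq Ω) b hb, Finset.mem_univ _,
      AdjoinRoot.liftAlgHom_root P (Algebra.ofId Fq Ω) b hb⟩
  · intro σ _
    rw [eval_map_algebraMap, aeval_algHom_apply, AdjoinRoot.aeval_eq]

lemma quadCharP_eq_quadraticChar_resultant (h2 : ringChar Fq ≠ 2) {P : Fq[X]}
    (hP : Irreducible P) (hm : P.Monic) (f : Fq[X]) :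
    quadCharP f P = quadraticChar Fq (resultant P f) := by
  have := Fact.mk hP
  have h2' := ringChar_adjoinRoot P h2
  have hodd := FiniteField.odd_card_of_char_ne_two h2
  rw [← norm_mk_eq_resultant hP hm, quadCharP_eq_quadraticChar]
  set a := AdjoinRoot.mk P f
  have : Module.Finite Fq (AdjoinRoot P) := (AdjoinRoot.powerBasis hP.ne_zero).finite
  by_cases ha : a = 0
  · simp only [ha, Algebra.norm_zero, quadraticChar_zero]
  have hN : Algebra.norm Fq a ≠ 0 := by simpa using ha
  have key : ((quadraticChar (AdjoinRoot P) a : ℤ) : AdjoinRoot P)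
      = ((quadraticChar Fq (Algebra.norm Fq a) : ℤ) : AdjoinRoot P) := by
    have h3 := congrArg (algebraMap Fq (AdjoinRoot P))
      (quadraticChar_eq_pow_of_char_ne_two' h2 (Algebra.norm Fq a))
    rw [map_intCast, map_pow, FiniteField.algebraMap_norm_eq_pow, ← pow_mul] at h3
    rw [h3, quadraticChar_eq_pow_of_char_ne_two' h2']
    congr 1
    rw [Nat.card_eq_fintype_card, Nat.card_eq_fintype_card, card_adjoinRoot]
    set q := Fintype.card Fq with hq
    have h3 := Nat.geomSum_eq (m := q) Fintype.one_lt_card P.natDegree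
    have h4 := geom_sum_mul_add (q - 1) P.natDegree
    have h6 : q - 1 + 1 = q := by omega
    rw [h6] at h4
    rw [← h3]
    have h5 : q - 1 = 2 * (q / 2) := by omega
    rw [h5] at h4
    generalize (∑ i ∈ Finset.range P.natDegree, q ^ i) = S at *
    rw [← h4]
    have : S * (2 * (q / 2)) = 2 * (S * (q / 2)) := by ring
    omega
  have hne : (1 : AdjoinRoot P) ≠ -1 := by
    exact (Ring.neg_one_ne_one_of_char_ne_two h2').symm
  rcases quadraticChar_dichotomy ha with h | h <;>
  rcases quadraticChar_dichotomy hN with h' | h' <;>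
  rw [h, h'] at key ⊢ <;> push_cast at key
  · exact absurd key hne
  · exact absurd key.symm hne

lemma quadCharP_congr_right {p p' : Fq[X]} (h : Associated p p') (D : Fq[X]) :
    quadCharP D p = quadCharP D p' := by
  simp only [quadCharP, h.dvd_iff_dvd_left]

lemma normalize_irreducible {p : Fq[X]} (hp : Irreducible p) : Irreducible (normalize p) :=
  (normalize_associated p).symm.irreducible hp

/-- Quadratic reciprocity between monic irreducible polynomials. -/
lemma quadCharP_reciprocity (h2 : ringChar Fq ≠ 2) {P p : Fq[X]}
    (hP : Irreducible P) (hm : P.Monic) (hp : Irreducible p) (hpm : p.Monic) :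
    quadCharP P p = (quadraticChar Fq (-1) ^ P.natDegree) ^ p.natDegree * quadCharP p P := by
  rw [quadCharP_eq_quadraticChar_resultant h2 hP hm,
    quadCharP_eq_quadraticChar_resultant h2 hp hpm, resultant_comm, map_mul, map_pow,
    mul_comm p.natDegree, pow_mul]

/-- Quadratic reciprocity for the symbol `(P/f)`. -/
lemma jacobi_reciprocity (h2 : ringChar Fq ≠ 2) {P f : Fq[X]}
    (hP : Irreducible P) (hm : P.Monic) (hf : f.Monic) :
    jacobi P f = (quadraticChar Fq (-1) ^ P.natDegree) ^ f.natDegree * quadCharP f P := by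
  have key : ∀ s : Multiset Fq[X], (∀ p ∈ s, Irreducible p) →
      (s.map (quadCharP P)).prod = (quadraticChar Fq (-1) ^ P.natDegree) ^
        ((s.map normalize).prod).natDegree * quadCharP ((s.map normalize).prod) P := by
    intro s
    induction s using Multiset.induction with
    | empty => intro _; simp [quadCharP_one hP]
    | cons a s ih =>
      intro h
      have ha : Irreducible a := h a (Multiset.mem_cons_self a s)
      have ha' := normalize_irreducible ha
      have ih' := ih fun p hp => h p (Multiset.mem_cons_of_mem hp)
      have hs : (s.map normalize).prod ≠ 0 := by
        refine Multiset.prod_ne_zero fun h0 => ?_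
        obtain ⟨b, hb, hb0⟩ := Multiset.mem_map.mp h0
        exact (h b (Multiset.mem_cons_of_mem hb)).ne_zero (by simpa using hb0)
      rw [Multiset.map_cons, Multiset.prod_cons, Multiset.map_cons, Multiset.prod_cons, ih',
        natDegree_mul ha'.ne_zero hs, quadCharP_mul hP, pow_add,
        quadCharP_congr_right (normalize_associated a).symm,
        quadCharP_reciprocity h2 hP hm ha' (monic_normalize ha.ne_zero)]
      ring
  have hirr : ∀ p ∈ UniqueFactorizationMonoid.factors f, Irreducible p :=
    UniqueFactorizationMonoid.irreducible_of_factor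
  rw [jacobi, key _ hirr]
  have : ((UniqueFactorizationMonoid.factors f).map normalize).prod = f := by
    have h1 := UniqueFactorizationMonoid.factors_prod hf.ne_zero
    have h3 : ∀ s : Multiset Fq[X], (s.map normalize).prod = normalize s.prod := by
      intro s
      induction s using Multiset.induction with
      | empty => simp
      | cons a s ih => rw [Multiset.map_cons, Multiset.prod_cons, Multiset.prod_cons, ih, normalize_mul]
    rw [h3, normalize_eq_normalize_iff_associated.mpr h1, hf.normalize_eq_self]
  rw [this]

noncomputable instance degreeLTFintype (m : ℕ) : Fintype (degreeLT Fq m) :=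
  Fintype.ofEquiv _ (degreeLTEquiv Fq m).symm.toEquiv

/-- Polynomials of degree less than `m`. -/
noncomputable def lowDeg (Fq : Type) [Field Fq] [Fintype Fq] (m : ℕ) : Finset Fq[X] :=
  Finset.univ.map ⟨fun f : degreeLT Fq m => (f : Fq[X]), Subtype.val_injective⟩

/-- Monic polynomials of degree `m`, as a finite set. -/
noncomputable def monDeg (Fq : Type) [Field Fq] [Fintype Fq] (m : ℕ) : Finset Fq[X] :=
  (lowDeg Fq m).map ⟨fun r => X ^ m + r, add_right_injective _⟩

lemma mem_lowDeg {m : ℕ} {f : Fq[X]} : f ∈ lowDeg Fq m ↔ f.degree < m := by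
  simp [lowDeg, mem_degreeLT]

lemma mem_lowDeg_iff {m : ℕ} {f : Fq[X]} : f ∈ lowDeg Fq m ↔ ∀ i, m ≤ i → f.coeff i = 0 := by
  rw [mem_lowDeg, degree_lt_iff_coeff_zero]

lemma card_lowDeg (m : ℕ) : (lowDeg Fq m).card = Fintype.card Fq ^ m := by
  rw [lowDeg, Finset.card_map, Finset.card_univ,
    Fintype.card_congr (degreeLTEquiv Fq m).toEquiv]
  simp

lemma mem_monDeg {m : ℕ} {f : Fq[X]} : f ∈ monDeg Fq m ↔ f.Monic ∧ f.natDegree = m := by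
  simp only [monDeg, Finset.mem_map, Function.Embedding.coeFn_mk, mem_lowDeg]
  constructor
  · rintro ⟨r, hr, rfl⟩
    exact ⟨monic_X_pow_add hr, natDegree_eq_of_degree_eq_some (by
      rw [degree_add_eq_left_of_degree_lt (by rwa [degree_X_pow]), degree_X_pow])⟩
  · rintro ⟨hf, rfl⟩
    refine ⟨f - X ^ f.natDegree, ?_, by ring⟩
    rw [degree_lt_iff_coeff_zero]
    intro i hi
    rcases hi.eq_or_lt with rfl | hi
    · simp [hf]
    · simp [coeff_eq_zero_of_natDegree_lt hi, coeff_X_pow, hi.ne']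

lemma card_monDeg (m : ℕ) : (monDeg Fq m).card = Fintype.card Fq ^ m := by
  rw [monDeg, Finset.card_map, card_lowDeg]

lemma coe_monDeg (m : ℕ) : (monDeg Fq m : Set Fq[X]) = monicDeg Fq m := by
  ext f
  simp [mem_monDeg, monicDeg]

lemma sum_monDeg {M : Type*} [AddCommMonoid M] (m : ℕ) (F : Fq[X] → M) :
    ∑ f ∈ monDeg Fq m, F f = ∑ r ∈ lowDeg Fq m, F (X ^ m + r) := by
  rw [monDeg, Finset.sum_map]
  rfl

lemma add_mem_lowDeg {m : ℕ} {f g : Fq[X]} (hf : f ∈ lowDeg Fq m) (hg : g ∈ lowDeg Fq m) :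
    f + g ∈ lowDeg Fq m := by
  rw [mem_lowDeg_iff] at *
  intro i hi
  rw [coeff_add, hf i hi, hg i hi, add_zero]

lemma neg_mem_lowDeg {m : ℕ} {f : Fq[X]} (hf : f ∈ lowDeg Fq m) : -f ∈ lowDeg Fq m := by
  rw [mem_lowDeg] at *
  rwa [degree_neg]

lemma C_mul_mem_lowDeg {m : ℕ} {f : Fq[X]} (c : Fq) (hf : f ∈ lowDeg Fq m) :
    C c * f ∈ lowDeg Fq m := by
  rw [mem_lowDeg_iff] at *
  intro i hi
  rw [coeff_C_mul, hf i hi, mul_zero]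

lemma zero_mem_lowDeg (m : ℕ) : (0 : Fq[X]) ∈ lowDeg Fq m := by
  simp [mem_lowDeg_iff]

lemma sum_lowDeg_add {M : Type*} [AddCommMonoid M] (a b : ℕ) (F : Fq[X] → M) :
    ∑ f ∈ lowDeg Fq (a + b), F f = ∑ u ∈ lowDeg Fq a, ∑ v ∈ lowDeg Fq b, F (u + X ^ a * v) := by
  rw [← Finset.sum_product']
  symm
  refine Finset.sum_bij (fun p _ => p.1 + X ^ a * p.2) ?_ ?_ ?_ ?_
  · rintro ⟨u, v⟩ h
    rw [Finset.mem_product] at h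
    simp only [mem_lowDeg_iff] at h ⊢
    intro i hi
    rw [coeff_add, h.1 i (by omega), zero_add, coeff_X_pow_mul', if_pos (by omega),
      h.2 _ (by omega)]
  · rintro ⟨u, v⟩ h ⟨u', v'⟩ h' e
    rw [Finset.mem_product] at h h'
    simp only [mem_lowDeg_iff] at h h' e
    have hu : u = u' := by
      ext i
      rcases lt_or_ge i a with hi | hi
      · have := congrArg (fun f => coeff f i) e
        simpa [coeff_X_pow_mul', hi.not_ge] using this
      · rw [h.1 i hi, h'.1 i hi]
    subst hu
    have := mul_left_cancel₀ (pow_ne_zero a X_ne_zero) (add_left_cancel e)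
    rw [this]
  · intro f hf
    rw [mem_lowDeg] at hf
    have hd : (X ^ a : Fq[X]) ∣ f - f %ₘ X ^ a := by
      refine ⟨f /ₘ X ^ a, ?_⟩
      linear_combination -(modByMonic_add_div f (X ^ a))
    refine ⟨(f %ₘ X ^ a, f /ₘ X ^ a), ?_, modByMonic_add_div f (X ^ a)⟩
    rw [Finset.mem_product]
    constructor
    · rw [mem_lowDeg]
      simpa using degree_modByMonic_lt f (monic_X_pow a)
    · rw [mem_lowDeg]
      by_cases h0 : f /ₘ X ^ a = 0
      · simp [h0]
      have hfa : f ≠ 0 := by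
        rintro rfl
        simp at h0
      rw [degree_eq_natDegree hfa] at hf
      have hf' : f.natDegree < a + b := by exact_mod_cast hf
      rw [degree_eq_natDegree h0, natDegree_divByMonic _ (monic_X_pow a), natDegree_X_pow]
      have : a ≤ f.natDegree := by
        by_contra hlt
        apply h0
        rw [divByMonic_eq_zero_iff (monic_X_pow a), degree_X_pow]
        exact lt_of_le_of_lt degree_le_natDegree (by exact_mod_cast not_le.mp hlt)
      exact_mod_cast (by omega : f.natDegree - a < b)
  · intros
    rfl

lemma sum_lowDeg_one {M : Type*} [AddCommMonoid M] (F : Fq[X] → M) :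
    ∑ f ∈ lowDeg Fq 1, F f = ∑ c : Fq, F (C c) := by
  symm
  refine Finset.sum_bij (fun c _ => C c) ?_ ?_ ?_ ?_
  · intro c _
    rw [mem_lowDeg]
    exact lt_of_le_of_lt degree_C_le (by norm_num)
  · intro a _ b _ h
    exact C_injective h
  · intro f hf
    rw [mem_lowDeg] at hf
    exact ⟨f.coeff 0, Finset.mem_univ _, (eq_C_of_degree_le_zero (by
      rw [degree_le_iff_coeff_zero]
      intro i hi
      rw [degree_lt_iff_coeff_zero] at hf
      exact hf i (by exact_mod_cast hi))).symm⟩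
  · intros
    rfl

lemma sum_lowDeg_succ {M : Type*} [AddCommMonoid M] (m : ℕ) (F : Fq[X] → M) :
    ∑ f ∈ lowDeg Fq (m + 1), F f = ∑ c : Fq, ∑ r ∈ lowDeg Fq m, F (r + C c * X ^ m) := by
  rw [sum_lowDeg_add, Finset.sum_comm, sum_lowDeg_one]
  simp only [mul_comm]

/-- A character sum over an additively closed set vanishes when some translation acts
nontrivially. -/
lemma sum_lowDeg_eq_zero {m : ℕ} (E : Fq[X] → ℂ) {r₀ : Fq[X]} {z : ℂ} (hr₀ : r₀ ∈ lowDeg Fq m)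
    (hz : z ≠ 1) (h : ∀ r ∈ lowDeg Fq m, E (r₀ + r) = z * E r) :
    ∑ r ∈ lowDeg Fq m, E r = 0 := by
  have h1 : ∑ r ∈ lowDeg Fq m, E (r₀ + r) = ∑ r ∈ lowDeg Fq m, E r := by
    refine Finset.sum_bij (fun r _ => r₀ + r) (fun r hr => add_mem_lowDeg hr₀ hr)
      (fun a _ b _ hab => add_left_cancel hab) (fun r hr => ⟨r - r₀, ?_, by ring⟩) (fun _ _ => rfl)
    rw [sub_eq_add_neg]
    exact add_mem_lowDeg hr (neg_mem_lowDeg hr₀)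
  rw [Finset.sum_congr rfl h, ← Finset.mul_sum] at h1
  have h2 : (z - 1) * ∑ r ∈ lowDeg Fq m, E r = 0 := by linear_combination h1
  exact (mul_eq_zero.mp h2).resolve_left (sub_ne_zero.mpr hz)

lemma quadCharP_congr {P : Fq[X]} {f g : Fq[X]} (h : P ∣ f - g) :
    quadCharP f P = quadCharP g P := by
  have h1 : P ∣ f ↔ P ∣ g := (dvd_iff_dvd_of_dvd_sub h)
  have h2 : ∀ x : Fq[X], P ∣ x ^ 2 - f ↔ P ∣ x ^ 2 - g := fun x =>
    dvd_iff_dvd_of_dvd_sub (by rw [← dvd_neg]; convert h using 1; ring)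
  simp only [quadCharP, h1, h2]

lemma dvd_sub_modByMonic (P f : Fq[X]) : P ∣ f - f %ₘ P :=
  ⟨f /ₘ P, by linear_combination -(modByMonic_add_div f P)⟩

lemma quadCharP_modByMonic (P f : Fq[X]) : quadCharP (f %ₘ P) P = quadCharP f P :=
  (quadCharP_congr (dvd_sub_modByMonic P f)).symm

lemma eq_zero_of_dvd_of_mem_lowDeg {P f : Fq[X]} (hm : P.Monic) (hf : f ∈ lowDeg Fq P.natDegree)
    (h : P ∣ f) : f = 0 := by
  rw [mem_lowDeg, ← degree_eq_natDegree hm.ne_zero] at hf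
  exact eq_zero_of_dvd_of_degree_lt h hf

lemma modByMonic_mem_lowDeg {P : Fq[X]} (hm : P.Monic) (f : Fq[X]) :
    f %ₘ P ∈ lowDeg Fq P.natDegree := by
  rw [mem_lowDeg, ← degree_eq_natDegree hm.ne_zero]
  exact degree_modByMonic_lt f hm

lemma modByMonic_of_mem_lowDeg {P f : Fq[X]} (hm : P.Monic)
    (hf : f ∈ lowDeg Fq P.natDegree) : f %ₘ P = f := by
  rw [mem_lowDeg, ← degree_eq_natDegree hm.ne_zero] at hf
  exact (modByMonic_eq_self_iff hm).mpr hf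

/-- The additive character modulo `P` attached to the top coefficient of the residue. -/
noncomputable def resChar (ψ : AddChar Fq ℂ) (P f : Fq[X]) : ℂ :=
  ψ ((f %ₘ P).coeff (P.natDegree - 1))

lemma resChar_add (ψ : AddChar Fq ℂ) (P f g : Fq[X]) :
    resChar ψ P (f + g) = resChar ψ P f * resChar ψ P g := by
  rw [resChar, add_modByMonic, coeff_add, AddChar.map_add_eq_mul]
  rfl

lemma resChar_congr (ψ : AddChar Fq ℂ) {P f g : Fq[X]} (hm : P.Monic) (h : P ∣ f - g) :
    resChar ψ P f = resChar ψ P g := by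
  rw [resChar, resChar, modByMonic_eq_of_dvd_sub hm h]

lemma resChar_modByMonic (ψ : AddChar Fq ℂ) {P : Fq[X]} (hm : P.Monic) (f : Fq[X]) :
    resChar ψ P (f %ₘ P) = resChar ψ P f :=
  (resChar_congr ψ hm (dvd_sub_modByMonic P f)).symm

lemma resChar_of_mem_lowDeg (ψ : AddChar Fq ℂ) {P f : Fq[X]} (hm : P.Monic)
    (hf : f ∈ lowDeg Fq P.natDegree) : resChar ψ P f = ψ (f.coeff (P.natDegree - 1)) := by
  rw [resChar, modByMonic_of_mem_lowDeg hm hf]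

lemma mul_mem_lowDeg {a b c : ℕ} {f g : Fq[X]} (hf : f ∈ lowDeg Fq a) (hg : g ∈ lowDeg Fq b)
    (hc : a + b ≤ c + 1) : f * g ∈ lowDeg Fq c := by
  by_cases hf0 : f = 0
  · rw [hf0, zero_mul]
    exact zero_mem_lowDeg c
  by_cases hg0 : g = 0
  · rw [hg0, mul_zero]
    exact zero_mem_lowDeg c
  rw [mem_lowDeg, degree_eq_natDegree hf0] at hf
  rw [mem_lowDeg, degree_eq_natDegree hg0] at hg
  rw [mem_lowDeg, degree_eq_natDegree (mul_ne_zero hf0 hg0), natDegree_mul hf0 hg0]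
  have h1 : f.natDegree < a := by exact_mod_cast hf
  have h2 : g.natDegree < b := by exact_mod_cast hg
  exact_mod_cast (by omega : f.natDegree + g.natDegree < c)

lemma mem_lowDeg_mono {a b : ℕ} (h : a ≤ b) {f : Fq[X]} (hf : f ∈ lowDeg Fq a) :
    f ∈ lowDeg Fq b := by
  rw [mem_lowDeg_iff] at *
  exact fun i hi => hf i (h.trans hi)

lemma X_pow_mem_lowDeg {a b : ℕ} (h : a < b) : (X ^ a : Fq[X]) ∈ lowDeg Fq b := by
  rw [mem_lowDeg, degree_X_pow]
  exact_mod_cast h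

/-- A monomial of prescribed degree moves a nonzero polynomial to the top coefficient. -/
lemma exists_resChar_ne_one {ψ : AddChar Fq ℂ} (hψ : ψ ≠ 1) {P β : Fq[X]} (hm : P.Monic)
    {j : ℕ} (hβ : β ≠ 0) (hj : j + β.natDegree + 1 = P.natDegree) :
    ∃ c : Fq, resChar ψ P (C c * X ^ j * β) ≠ 1 := by
  obtain ⟨a, ha⟩ := AddChar.ne_one_iff.mp hψ
  refine ⟨a * β.leadingCoeff⁻¹, ?_⟩
  rw [resChar_of_mem_lowDeg ψ hm]
  · have : P.natDegree - 1 = β.natDegree + j := by omega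
    rw [this, mul_assoc, coeff_C_mul, mul_comm (X ^ j), coeff_mul_X_pow, coeff_natDegree,
      mul_assoc, inv_mul_cancel₀ (leadingCoeff_ne_zero.mpr hβ), mul_one]
    exact ha
  · refine mul_mem_lowDeg (C_mul_mem_lowDeg _ (X_pow_mem_lowDeg (Nat.lt_succ_self j)))
      (b := β.natDegree + 1) ?_ (by omega)
    rw [mem_lowDeg]
    exact lt_of_le_of_lt degree_le_natDegree (by exact_mod_cast Nat.lt_succ_self _)

lemma sum_resChar_mul {ψ : AddChar Fq ℂ} (hψ : ψ ≠ 1) {P β : Fq[X]} (hm : P.Monic)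
    (hβ : β ∈ lowDeg Fq P.natDegree) {m : ℕ} (hmn : m ≤ P.natDegree) :
    ∑ r ∈ lowDeg Fq m, resChar ψ P (r * β) =
      if β ∈ lowDeg Fq (P.natDegree - m) then (Fintype.card Fq : ℂ) ^ m else 0 := by
  split_ifs with h
  · have : ∀ r ∈ lowDeg Fq m, resChar ψ P (r * β) = 1 := by
      intro r hr
      rcases Nat.eq_zero_or_pos P.natDegree with h0 | h0
      · have hb : β = 0 := by
          rw [h0, mem_lowDeg] at hβ
          simpa using hβ
        simp [hb, resChar]
      have h1 := mul_mem_lowDeg hr h (c := P.natDegree - 1) (by omega)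
      rw [resChar_of_mem_lowDeg ψ hm (mem_lowDeg_mono (by omega) h1), mem_lowDeg_iff.mp h1 _ le_rfl,
        AddChar.map_zero_eq_one]
    rw [Finset.sum_congr rfl this, Finset.sum_const, card_lowDeg]
    simp
  · have hb : β ≠ 0 := fun h0 => h (h0 ▸ zero_mem_lowDeg _)
    rw [mem_lowDeg, degree_eq_natDegree hb, Nat.cast_lt] at hβ h
    obtain ⟨c, hc⟩ := exists_resChar_ne_one hψ hm (j := P.natDegree - 1 - β.natDegree) hb
      (by omega)
    refine sum_lowDeg_eq_zero _ (r₀ := C c * X ^ (P.natDegree - 1 - β.natDegree))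
      (C_mul_mem_lowDeg _ (X_pow_mem_lowDeg (by omega))) hc fun r _ => ?_
    rw [add_mul, resChar_add]

/-- The Gauss sum modulo `P`. -/
noncomputable def gaussP (ψ : AddChar Fq ℂ) (P : Fq[X]) : ℂ :=
  ∑ β ∈ lowDeg Fq P.natDegree, (quadCharP β P : ℂ) * resChar ψ P β

lemma gaussP_mul (ψ : AddChar Fq ℂ) {P : Fq[X]} (hP : Irreducible P) (hm : P.Monic) {f : Fq[X]}
    (hf : ¬ P ∣ f) :
    gaussP ψ P * quadCharP f P =
      ∑ β ∈ lowDeg Fq P.natDegree, (quadCharP β P : ℂ) * resChar ψ P (f * β) := by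
  have hinj : Set.InjOn (fun β => (f * β) %ₘ P) (lowDeg Fq P.natDegree : Set Fq[X]) := by
    intro a ha b hb hab
    have h1 : P ∣ f * a - f * b := by
      have := (dvd_sub_modByMonic P (f * a)).sub (dvd_sub_modByMonic P (f * b))
      simp only at hab
      rw [hab] at this
      convert this using 1
      ring
    rw [← mul_sub] at h1
    have h2 := (hP.prime.dvd_or_dvd h1).resolve_left hf
    refine sub_eq_zero.mp (eq_zero_of_dvd_of_mem_lowDeg hm ?_ h2)
    rw [sub_eq_add_neg]
    exact add_mem_lowDeg ha (neg_mem_lowDeg hb)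
  have hmaps : ∀ β ∈ lowDeg Fq P.natDegree, (f * β) %ₘ P ∈ lowDeg Fq P.natDegree :=
    fun β _ => modByMonic_mem_lowDeg hm _
  have h1 : gaussP ψ P = ∑ β ∈ lowDeg Fq P.natDegree,
      (quadCharP (f * β) P : ℂ) * resChar ψ P (f * β) := by
    symm
    refine Finset.sum_bij (fun β _ => (f * β) %ₘ P) hmaps
      (fun a ha b hb hab => hinj ha hb hab) ?_ ?_
    · exact fun b hb => by
        obtain ⟨a, ha, hab⟩ := Finset.surjOn_of_injOn_of_card_le _ hmaps hinj le_rfl hb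
        exact ⟨a, ha, hab⟩
    · intro β _
      rw [quadCharP_modByMonic, resChar_modByMonic ψ hm]
  rw [h1, Finset.sum_mul]
  refine Finset.sum_congr rfl fun β _ => ?_
  have h2 : ((quadCharP f P : ℂ)) ^ 2 = 1 := by exact_mod_cast quadCharP_sq_eq_one hP hf
  rw [quadCharP_mul hP]
  push_cast
  linear_combination (quadCharP β P : ℂ) * resChar ψ P (f * β) * h2

/-- Sum of the quadratic character modulo `P` over monic polynomials of degree `m`. -/
noncomputable def aSum (P : Fq[X]) (m : ℕ) : ℤ := ∑ f ∈ monDeg Fq m, quadCharP f P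

lemma not_dvd_of_mem_monDeg {P f : Fq[X]} {m : ℕ} (hmn : m < P.natDegree)
    (hf : f ∈ monDeg Fq m) : ¬ P ∣ f := by
  rw [mem_monDeg] at hf
  intro h
  have := natDegree_le_of_dvd h hf.1.ne_zero
  omega

lemma lowDeg_filter {a b : ℕ} (h : a ≤ b) :
    (lowDeg Fq b).filter (· ∈ lowDeg Fq a) = lowDeg Fq a := by
  ext f
  simp only [Finset.mem_filter, and_iff_right_iff_imp]
  exact mem_lowDeg_mono h

lemma gaussP_mul_aSum {ψ : AddChar Fq ℂ} (hψ : ψ ≠ 1) {P : Fq[X]} (hP : Irreducible P)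
    (hm : P.Monic) {m : ℕ} (hmn : m < P.natDegree) :
    gaussP ψ P * aSum P m = (Fintype.card Fq : ℂ) ^ m *
      ∑ β ∈ lowDeg Fq (P.natDegree - m),
        (quadCharP β P : ℂ) * ψ (β.coeff (P.natDegree - 1 - m)) := by
  rw [aSum, Int.cast_sum, Finset.mul_sum, Finset.sum_congr rfl fun f hf =>
    gaussP_mul ψ hP hm (not_dvd_of_mem_monDeg hmn hf), sum_monDeg, Finset.sum_comm]
  have h1 : ∀ β ∈ lowDeg Fq P.natDegree, ∑ r ∈ lowDeg Fq m,
      (quadCharP β P : ℂ) * resChar ψ P ((X ^ m + r) * β) =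
      if β ∈ lowDeg Fq (P.natDegree - m) then (Fintype.card Fq : ℂ) ^ m *
        ((quadCharP β P : ℂ) * ψ (β.coeff (P.natDegree - 1 - m))) else 0 := by
    intro β hβ
    have h2 : ∀ r, (quadCharP β P : ℂ) * resChar ψ P ((X ^ m + r) * β) =
        (quadCharP β P : ℂ) * resChar ψ P (X ^ m * β) * resChar ψ P (r * β) := by
      intro r
      rw [add_mul, resChar_add, mul_assoc]
    rw [Finset.sum_congr rfl fun r _ => h2 r, ← Finset.mul_sum, sum_resChar_mul hψ hm hβ hmn.le]
    split_ifs with h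
    · have h3 : X ^ m * β ∈ lowDeg Fq P.natDegree :=
        mul_mem_lowDeg (X_pow_mem_lowDeg (Nat.lt_succ_self m)) h (by omega)
      rw [resChar_of_mem_lowDeg ψ hm h3, coeff_X_pow_mul', if_pos (by omega)]
      ring
    · rw [mul_zero]
  rw [Finset.sum_congr rfl h1, ← Finset.sum_filter, lowDeg_filter (Nat.sub_le _ _),
    ← Finset.mul_sum]

lemma sum_lowDeg_top_coeff (h2 : ringChar Fq ≠ 2) {P : Fq[X]} (hP : Irreducible P) (s : ℕ)
    (G : Fq → ℂ) :
    ∑ β ∈ lowDeg Fq (s + 1), (quadCharP β P : ℂ) * G (β.coeff s) =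
      G 0 * ∑ β ∈ lowDeg Fq s, (quadCharP β P : ℂ) +
        (∑ c : Fq, ((quadraticChar Fq c ^ P.natDegree : ℤ) : ℂ) * G c) * aSum P s := by
  have hn : P.natDegree ≠ 0 := hP.natDegree_pos.ne'
  rw [sum_lowDeg_succ]
  have h3 : ∀ c : Fq, ∑ r ∈ lowDeg Fq s, (quadCharP (r + C c * X ^ s) P : ℂ) *
      G ((r + C c * X ^ s).coeff s) = (if c = 0 then G 0 * ∑ β ∈ lowDeg Fq s, (quadCharP β P : ℂ)
        else 0) + ((quadraticChar Fq c ^ P.natDegree : ℤ) : ℂ) * G c * aSum P s := by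
    intro c
    have hc : ∀ r ∈ lowDeg Fq s, (r + C c * X ^ s).coeff s = c := by
      intro r hr
      rw [coeff_add, mem_lowDeg_iff.mp hr s le_rfl]
      simp
    split_ifs with h0
    · rw [h0]
      simp only [map_zero, quadraticChar_zero, zero_mul, add_zero, zero_pow hn, Int.cast_zero]
      rw [Finset.mul_sum]
      refine Finset.sum_congr rfl fun r hr => ?_
      rw [mem_lowDeg_iff.mp hr s le_rfl, mul_comm]
    · rw [zero_add, aSum, Int.cast_sum, Finset.mul_sum, sum_monDeg]
      symm
      refine Finset.sum_bij (fun r _ => C c * r) (fun r hr => C_mul_mem_lowDeg c hr) ?_ ?_ ?_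
      · intro a _ b _ hab
        exact mul_left_cancel₀ (C_ne_zero.mpr h0) hab
      · intro b hb
        refine ⟨C c⁻¹ * b, C_mul_mem_lowDeg _ hb, ?_⟩
        rw [← mul_assoc, ← C_mul, mul_inv_cancel₀ h0, C_1, one_mul]
      · intro r hr
        rw [hc _ (C_mul_mem_lowDeg c hr), add_comm (C c * r), ← mul_add, quadCharP_mul hP,
          quadCharP_C hP h2]
        push_cast
        ring
  rw [Finset.sum_congr rfl fun c _ => h3 c, Finset.sum_add_distrib, Finset.sum_mul]
  simp

lemma aSum_zero {P : Fq[X]} (hP : Irreducible P) : aSum P 0 = 1 := by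
  have : monDeg Fq 0 = {1} := by
    ext f
    rw [mem_monDeg, Finset.mem_singleton]
    constructor
    · rintro ⟨h1, h2⟩
      exact h1.natDegree_eq_zero.mp h2
    · rintro rfl
      simp
  rw [aSum, this, Finset.sum_singleton, quadCharP_one hP]

lemma odd_card_of_ringChar_ne_two (h2 : ringChar Fq ≠ 2) : Odd (Fintype.card Fq) :=
  Nat.odd_iff.mpr (FiniteField.odd_card_of_char_ne_two h2)

lemma odd_aSum (h2 : ringChar Fq ≠ 2) {P : Fq[X]} (hP : Irreducible P)
    {m : ℕ} (hmn : m < P.natDegree) : Odd (aSum P m) := by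
  rw [← Int.not_even_iff_odd, even_iff_two_dvd, ← Nat.cast_ofNat,
    ← ZMod.intCast_zmod_eq_zero_iff_dvd]
  have h1 : ∀ f ∈ monDeg Fq m, ((quadCharP f P : ℤ) : ZMod 2) = 1 := by
    intro f hf
    rcases quadCharP_eq_one_or hP (not_dvd_of_mem_monDeg hmn hf) with h | h <;> rw [h] <;> decide
  rw [aSum, Int.cast_sum, Finset.sum_congr rfl h1, Finset.sum_const, card_monDeg, nsmul_eq_mul,
    mul_one]
  rw [ZMod.natCast_eq_zero_iff, ← even_iff_two_dvd, Nat.not_even_iff_odd]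
  exact (odd_card_of_ringChar_ne_two h2).pow

lemma sum_lowDeg_quadCharP_odd (h2 : ringChar Fq ≠ 2) {P : Fq[X]} (hP : Irreducible P)
    (hn : Odd P.natDegree) (s : ℕ) : ∑ β ∈ lowDeg Fq s, (quadCharP β P : ℂ) = 0 := by
  induction s with
  | zero =>
    have : lowDeg Fq 0 = {0} := by
      ext f
      simp [mem_lowDeg]
    rw [this, Finset.sum_singleton, (quadCharP_eq_zero_iff hP 0).mpr (dvd_zero P), Int.cast_zero]
  | succ s ih =>
    have h := sum_lowDeg_top_coeff h2 hP s fun _ => 1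
    simp only [mul_one, ih] at h
    have hc : ∀ c : Fq, (quadraticChar Fq c ^ P.natDegree : ℤ) = quadraticChar Fq c := by
      intro c
      by_cases hc : c = 0
      · rw [hc, quadraticChar_zero, zero_pow hP.natDegree_pos.ne']
      · obtain ⟨k, hk⟩ := hn
        rw [hk, pow_succ, pow_mul, quadraticChar_sq_one hc, one_pow, one_mul]
    rw [h, ← Int.cast_sum, Finset.sum_congr rfl fun c _ => hc c, quadraticChar_sum_zero h2]
    simp

/-- The functional equation for prime moduli of odd degree. -/
lemma aSum_functional_odd (h2 : ringChar Fq ≠ 2) {P : Fq[X]} (hP : Irreducible P) (hm : P.Monic)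
    {g : ℕ} (hn : P.natDegree = 2 * g + 1) {m : ℕ} (hmg : m ≤ 2 * g) :
    (Fintype.card Fq : ℤ) ^ g * aSum P m = (Fintype.card Fq : ℤ) ^ m * aSum P (2 * g - m) := by
  have hodd : Odd P.natDegree := ⟨g, hn⟩
  set q := Fintype.card Fq with hq
  have hprim := AddChar.FiniteField.primitiveChar_to_Complex_isPrimitive Fq
  set ψ := AddChar.FiniteField.primitiveChar_to_Complex Fq
  have hψ : ψ ≠ 1 := by simpa [AddChar.mulShift_one] using hprim one_ne_zero
  set γ : ℂ := ∑ c : Fq, ((quadraticChar Fq c ^ P.natDegree : ℤ) : ℂ) * ψ c with hγ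
  have hγ0 : γ ≠ 0 := by
    have hc : ∀ c : Fq, (quadraticChar Fq c ^ P.natDegree : ℤ) = quadraticChar Fq c := by
      intro c
      by_cases hc : c = 0
      · rw [hc, quadraticChar_zero, zero_pow hP.natDegree_pos.ne']
      · rw [hn, pow_succ, pow_mul, quadraticChar_sq_one hc, one_pow, one_mul]
    have h1 : γ = gaussSum ((quadraticChar Fq).ringHomComp (Int.castRingHom ℂ)) ψ := by
      rw [hγ, gaussSum]
      exact Finset.sum_congr rfl fun c _ => by rw [hc]; rfl
    rw [h1]
    refine gaussSum_ne_zero_of_nontrivial (by simp) ?_ hprim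
    exact (MulChar.ringHomComp_ne_one_iff Int.cast_injective).mpr (quadraticChar_ne_one h2)
  have key : ∀ m ≤ 2 * g, gaussP ψ P * aSum P m = (q : ℂ) ^ m * (γ * aSum P (2 * g - m)) := by
    intro m hmg
    rw [gaussP_mul_aSum hψ hP hm (by omega)]
    have e1 : P.natDegree - m = (2 * g - m) + 1 := by omega
    have e2 : P.natDegree - 1 - m = 2 * g - m := by omega
    rw [e1, e2, sum_lowDeg_top_coeff h2 hP, sum_lowDeg_quadCharP_odd h2 hP hodd, mul_zero, zero_add]
  have k0 := key 0 (Nat.zero_le _)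
  have kg := key g (by omega)
  have k2 := key m hmg
  rw [aSum_zero hP] at k0
  have e3 : 2 * g - g = g := by omega
  rw [e3] at kg
  simp only [Int.cast_one, mul_one, pow_zero, one_mul, Nat.sub_zero] at k0
  rw [k0] at kg k2
  have hag : (aSum P g : ℂ) ≠ 0 := by
    have := odd_aSum h2 hP (m := g) (by omega)
    intro h
    have h' : aSum P g = 0 := by exact_mod_cast h
    rw [h'] at this
    exact absurd this (by decide)
  have h3 : (aSum P (2 * g) : ℂ) = (q : ℂ) ^ g := by
    apply mul_right_cancel₀ (mul_ne_zero hγ0 hag)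
    linear_combination kg
  rw [h3] at k2
  have : (q : ℂ) ^ g * aSum P m = (q : ℂ) ^ m * aSum P (2 * g - m) := by
    apply mul_left_cancel₀ hγ0
    linear_combination k2
  exact_mod_cast this

lemma card_sq_modByMonic (h2 : ringChar Fq ≠ 2) {P : Fq[X]} (hP : Irreducible P) (hm : P.Monic)
    {β : Fq[X]} (hβ : β ∈ lowDeg Fq P.natDegree) :
    ((((lowDeg Fq P.natDegree).filter fun x => (x ^ 2) %ₘ P = β).card : ℤ)) =
      1 + quadCharP β P := by
  have hiff : ∀ x : Fq[X], (x ^ 2) %ₘ P = β ↔ P ∣ x ^ 2 - β := by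
    intro x
    constructor
    · rintro rfl
      exact dvd_sub_modByMonic P _
    · intro h
      rw [modByMonic_eq_of_dvd_sub hm h, modByMonic_of_mem_lowDeg hm hβ]
  have hsub : ∀ {a b : Fq[X]}, a ∈ lowDeg Fq P.natDegree → b ∈ lowDeg Fq P.natDegree →
      P ∣ a - b → a = b := by
    intro a b ha hb h
    refine sub_eq_zero.mp (eq_zero_of_dvd_of_mem_lowDeg hm ?_ h)
    rw [sub_eq_add_neg]
    exact add_mem_lowDeg ha (neg_mem_lowDeg hb)
  simp only [hiff]
  by_cases h0 : P ∣ β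
  · have hb0 : β = 0 := eq_zero_of_dvd_of_mem_lowDeg hm hβ h0
    rw [(quadCharP_eq_zero_iff hP β).mpr h0, hb0]
    have : ((lowDeg Fq P.natDegree).filter fun x => P ∣ x ^ 2 - 0) = {0} := by
      ext x
      rw [Finset.mem_filter, Finset.mem_singleton, sub_zero]
      constructor
      · rintro ⟨hx, h⟩
        exact eq_zero_of_dvd_of_mem_lowDeg hm hx (hP.prime.dvd_of_dvd_pow h)
      · rintro rfl
        exact ⟨zero_mem_lowDeg _, by simp⟩
    rw [this]
    simp
  by_cases hx : ∃ x : Fq[X], P ∣ x ^ 2 - β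
  · have hq : quadCharP β P = 1 := by rw [quadCharP, if_neg h0, if_pos hx]
    obtain ⟨y, hy⟩ := hx
    set x := y %ₘ P with hxdef
    have hx : P ∣ x ^ 2 - β := by
      have h1 : P ∣ y ^ 2 - x ^ 2 := by
        rw [sq_sub_sq]
        exact (dvd_sub_modByMonic P y).mul_left _
      have := hy.sub h1
      convert this using 1
      ring
    have hxl : x ∈ lowDeg Fq P.natDegree := modByMonic_mem_lowDeg hm y
    have hP2 : ¬ P ∣ (2 : Fq[X]) := by
      intro h
      have h3 : IsUnit (2 : Fq[X]) := by
        have : (2 : Fq[X]) = C 2 := (map_ofNat C 2).symm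
        rw [this]
        exact isUnit_C.mpr (Ne.isUnit (Ring.two_ne_zero h2))
      exact hP.not_isUnit (isUnit_of_dvd_unit h h3)
    have hne : x ≠ -x := by
      intro h
      have h3 : 2 * x = 0 := by linear_combination h
      have h4 : x = 0 := by
        rcases mul_eq_zero.mp h3 with h | h
        · exact absurd (h ▸ dvd_zero P) hP2
        · exact h
      rw [h4] at hx
      apply h0
      rw [← dvd_neg]
      simpa using hx
    have : ((lowDeg Fq P.natDegree).filter fun x => P ∣ x ^ 2 - β) = {x, -x} := by
      ext z
      rw [Finset.mem_filter, Finset.mem_insert, Finset.mem_singleton]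
      constructor
      · rintro ⟨hz, h⟩
        have h3 : P ∣ (z - x) * (z - -x) := by
          convert h.sub hx using 1
          ring
        rcases hP.prime.dvd_or_dvd h3 with h | h
        · exact Or.inl (hsub hz hxl h)
        · exact Or.inr (hsub hz (neg_mem_lowDeg hxl) h)
      · rintro (rfl | rfl)
        · exact ⟨hxl, hx⟩
        · exact ⟨neg_mem_lowDeg hxl, by rwa [neg_sq]⟩
    rw [this, Finset.card_pair hne, hq]
    norm_num
  · have hq : quadCharP β P = -1 := by rw [quadCharP, if_neg h0, if_neg hx]
    rw [hq, Finset.filter_false_of_mem]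
    · simp
    · exact fun x _ h => hx ⟨x, h⟩

lemma sum_sq_modByMonic (h2 : ringChar Fq ≠ 2) {P : Fq[X]} (hP : Irreducible P) (hm : P.Monic)
    (F : Fq[X] → ℂ) : ∑ x ∈ lowDeg Fq P.natDegree, F ((x ^ 2) %ₘ P) =
      ∑ β ∈ lowDeg Fq P.natDegree, (1 + (quadCharP β P : ℂ)) * F β := by
  rw [← Finset.sum_fiberwise_of_maps_to (s := lowDeg Fq P.natDegree) (t := lowDeg Fq P.natDegree)
    (g := fun x => (x ^ 2) %ₘ P) fun x _ => modByMonic_mem_lowDeg hm _]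
  refine Finset.sum_congr rfl fun β hβ => ?_
  have h1 : ∀ x ∈ (lowDeg Fq P.natDegree).filter fun x => (x ^ 2) %ₘ P = β,
      F ((x ^ 2) %ₘ P) = F β := fun x hx => by rw [(Finset.mem_filter.mp hx).2]
  rw [Finset.sum_congr rfl h1, Finset.sum_const, nsmul_eq_mul]
  congr 1
  exact_mod_cast card_sq_modByMonic h2 hP hm hβ

lemma sum_lowDeg_quadCharP (h2 : ringChar Fq ≠ 2) {P : Fq[X]} (hP : Irreducible P)
    (hm : P.Monic) : ∑ β ∈ lowDeg Fq P.natDegree, (quadCharP β P : ℂ) = 0 := by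
  have h := sum_sq_modByMonic h2 hP hm fun _ => 1
  simp only [mul_one, Finset.sum_add_distrib] at h
  linear_combination -h

/-- The Gauss sum for a prime modulus of even degree. -/
lemma gaussP_even (h2 : ringChar Fq ≠ 2) {ψ : AddChar Fq ℂ} (hψ : ψ ≠ 1) {P : Fq[X]}
    (hP : Irreducible P) (hm : P.Monic) {h : ℕ} (hn : P.natDegree = 2 * h) :
    gaussP ψ P = (Fintype.card Fq : ℂ) ^ h := by
  have hpos := hP.natDegree_pos
  have h1 : ∑ β ∈ lowDeg Fq P.natDegree, resChar ψ P β = 0 := by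
    have := sum_resChar_mul hψ hm (β := 1) (m := P.natDegree)
      (by simpa using X_pow_mem_lowDeg (Fq := Fq) hpos) le_rfl
    rw [if_neg (by simp [mem_lowDeg])] at this
    simpa using this
  have h3 : gaussP ψ P = ∑ x ∈ lowDeg Fq P.natDegree, resChar ψ P (x ^ 2) := by
    have := sum_sq_modByMonic h2 hP hm (resChar ψ P)
    simp only [resChar_modByMonic ψ hm, add_mul, one_mul, Finset.sum_add_distrib, h1,
      zero_add] at this
    exact this.symm
  have htwo : (C 2 : Fq[X]) ≠ 0 := C_ne_zero.mpr (Ring.two_ne_zero h2)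
  rw [h3, hn, two_mul, sum_lowDeg_add, Finset.sum_comm]
  have h4 : ∀ v ∈ lowDeg Fq h, ∑ u ∈ lowDeg Fq h, resChar ψ P ((u + X ^ h * v) ^ 2) =
      if v = 0 then (Fintype.card Fq : ℂ) ^ h else 0 := by
    intro v hv
    have hv' : X ^ h * v ∈ lowDeg Fq P.natDegree :=
      mul_mem_lowDeg (X_pow_mem_lowDeg (Nat.lt_succ_self h)) hv (by omega)
    have hβ : C 2 * (X ^ h * v) ∈ lowDeg Fq P.natDegree := C_mul_mem_lowDeg _ hv'
    have h5 : ∀ u ∈ lowDeg Fq h, resChar ψ P ((u + X ^ h * v) ^ 2) =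
        resChar ψ P ((X ^ h * v) ^ 2) * resChar ψ P (u * (C 2 * (X ^ h * v))) := by
      intro u hu
      have h6 : resChar ψ P (u ^ 2) = 1 := by
        have h7 : u ^ 2 ∈ lowDeg Fq (P.natDegree - 1) := by
          rw [pow_two]
          exact mul_mem_lowDeg hu hu (by omega)
        rw [resChar_of_mem_lowDeg ψ hm (mem_lowDeg_mono (by omega) h7),
          mem_lowDeg_iff.mp h7 _ le_rfl, AddChar.map_zero_eq_one]
      have : (u + X ^ h * v) ^ 2 = (u ^ 2 + (X ^ h * v) ^ 2) + u * (C 2 * (X ^ h * v)) := by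
        rw [show (C 2 : Fq[X]) = 2 from map_ofNat C 2]
        ring
      rw [this, resChar_add, resChar_add, h6, one_mul]
    rw [Finset.sum_congr rfl h5, ← Finset.mul_sum, sum_resChar_mul hψ hm hβ (by omega)]
    split_ifs with h6 h7 h7
    · rw [h7]
      simp [resChar]
    · exfalso
      rw [mem_lowDeg_iff] at h6
      refine h7 (ext fun i => ?_)
      have := h6 (i + h) (by omega)
      rw [coeff_C_mul, coeff_X_pow_mul] at this
      simpa using (mul_eq_zero.mp this).resolve_left (Ring.two_ne_zero h2)
    · exfalso
      rw [h7] at h6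
      exact h6 (by simpa using zero_mem_lowDeg _)
    · rw [mul_zero]
  rw [Finset.sum_congr rfl h4, Finset.sum_ite_eq' (lowDeg Fq h) 0, if_pos (zero_mem_lowDeg h)]

lemma sum_lowDeg_quadCharP_even (h2 : ringChar Fq ≠ 2) {P : Fq[X]} (hP : Irreducible P)
    (hn : Even P.natDegree) (s : ℕ) : ∑ β ∈ lowDeg Fq s, (quadCharP β P : ℂ) =
      ((Fintype.card Fq : ℂ) - 1) * ∑ j ∈ Finset.range s, (aSum P j : ℂ) := by
  induction s with
  | zero =>
    have : lowDeg Fq 0 = {0} := by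
      ext f
      simp [mem_lowDeg]
    rw [this, Finset.sum_singleton, (quadCharP_eq_zero_iff hP 0).mpr (dvd_zero P), Int.cast_zero]
    simp
  | succ s ih =>
    have h := sum_lowDeg_top_coeff h2 hP s fun _ => 1
    simp only [mul_one, one_mul] at h
    rw [h, ih, Finset.sum_range_succ, mul_add]
    congr 2
    have hc : ∀ c : Fq, ((quadraticChar Fq c ^ P.natDegree : ℤ) : ℂ) =
        1 - if c = 0 then 1 else 0 := by
      intro c
      split_ifs with hc
      · rw [hc, quadraticChar_zero, zero_pow hP.natDegree_pos.ne']
        simp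
      · obtain ⟨k, hk⟩ := hn
        rw [hk, ← two_mul, pow_mul, quadraticChar_sq_one hc, one_pow]
        simp
    rw [Finset.sum_congr rfl fun c _ => hc c, Finset.sum_sub_distrib]
    simp

/-- Partial sums of the character sums `aSum`. -/
noncomputable def bSum (P : Fq[X]) (s : ℕ) : ℤ := ∑ j ∈ Finset.range s, aSum P j

lemma bSum_natDegree_even (h2 : ringChar Fq ≠ 2) {P : Fq[X]} (hP : Irreducible P)
    (hm : P.Monic) (hn : Even P.natDegree) : bSum P P.natDegree = 0 := by
  have h := sum_lowDeg_quadCharP_even h2 hP hn P.natDegree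
  rw [sum_lowDeg_quadCharP h2 hP hm] at h
  have hq : (Fintype.card Fq : ℂ) - 1 ≠ 0 := by
    rw [sub_ne_zero]
    exact_mod_cast Fintype.one_lt_card.ne'
  have := (mul_eq_zero.mp h.symm).resolve_left hq
  exact_mod_cast this

/-- The functional equation for prime moduli of even degree. -/
lemma bSum_functional_even (h2 : ringChar Fq ≠ 2) {P : Fq[X]} (hP : Irreducible P) (hm : P.Monic)
    {g : ℕ} (hn : P.natDegree = 2 * g + 2) {m : ℕ} (hmg : m ≤ 2 * g + 2) :
    (Fintype.card Fq : ℤ) ^ (g + 1) * bSum P m =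
      (Fintype.card Fq : ℤ) ^ m * bSum P (2 * g + 2 - m) := by
  have heven : Even P.natDegree := ⟨g + 1, by omega⟩
  set q := Fintype.card Fq with hq
  have hprim := AddChar.FiniteField.primitiveChar_to_Complex_isPrimitive Fq
  set ψ := AddChar.FiniteField.primitiveChar_to_Complex Fq
  have hψ : ψ ≠ 1 := by simpa [AddChar.mulShift_one] using hprim one_ne_zero
  have hγ : ∑ c : Fq, ((quadraticChar Fq c ^ P.natDegree : ℤ) : ℂ) * ψ c = -1 := by
    have hc : ∀ c : Fq, ((quadraticChar Fq c ^ P.natDegree : ℤ) : ℂ) * ψ c =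
        ψ c - if c = 0 then 1 else 0 := by
      intro c
      split_ifs with hc
      · rw [hc, quadraticChar_zero, zero_pow hP.natDegree_pos.ne']
        simp
      · obtain ⟨k, hk⟩ := heven
        rw [hk, ← two_mul, pow_mul, quadraticChar_sq_one hc, one_pow]
        simp
    rw [Finset.sum_congr rfl fun c _ => hc c, Finset.sum_sub_distrib,
      AddChar.sum_eq_zero_of_ne_one hψ]
    simp
  have key : ∀ m < 2 * g + 2, (q : ℤ) ^ (g + 1) * (bSum P (m + 1) - bSum P m) =
      (q : ℤ) ^ m * (q * bSum P (2 * g + 1 - m) - bSum P (2 * g + 2 - m)) := by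
    intro m hmg
    have h := gaussP_mul_aSum hψ hP hm (m := m) (by omega)
    have e1 : P.natDegree - m = (2 * g + 1 - m) + 1 := by omega
    have e2 : P.natDegree - 1 - m = 2 * g + 1 - m := by omega
    have e3 : 2 * g + 2 - m = (2 * g + 1 - m) + 1 := by omega
    rw [gaussP_even h2 hψ hP hm (h := g + 1) (by omega), e1, e2, sum_lowDeg_top_coeff h2 hP, hγ,
      AddChar.map_zero_eq_one, sum_lowDeg_quadCharP_even h2 hP heven] at h
    have h' : (q : ℤ) ^ (g + 1) * aSum P m = (q : ℤ) ^ m * (1 * ((q - 1) *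
        bSum P (2 * g + 1 - m)) + -1 * aSum P (2 * g + 1 - m)) := by
      rw [bSum]
      exact_mod_cast h
    rw [e3]
    have s1 : ∀ s, bSum P (s + 1) = bSum P s + aSum P s := fun s => by
      rw [bSum, Finset.sum_range_succ, bSum]
    rw [s1, s1]
    linear_combination h'
  induction m with
  | zero =>
    have := bSum_natDegree_even h2 hP hm heven
    rw [hn] at this
    rw [Nat.sub_zero, this]
    simp [bSum]
  | succ m ih =>
    have h1 := ih (by omega)
    have h3 := key m (by omega)
    have e3 : 2 * g + 2 - (m + 1) = 2 * g + 1 - m := by omega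
    rw [e3, pow_succ (q : ℤ) m]
    linear_combination h1 + h3

/-- The quantity `q^{-1/2}`. -/
noncomputable def tq (Fq : Type) [Fintype Fq] : ℝ := (Real.sqrt (Fintype.card Fq))⁻¹

lemma tq_sq : tq Fq ^ 2 * (Fintype.card Fq : ℝ) = 1 := by
  have : (Fintype.card Fq : ℝ) ≠ 0 := by exact_mod_cast Fintype.card_ne_zero
  rw [tq, inv_pow, Real.sq_sqrt (Nat.cast_nonneg _), inv_mul_cancel₀ this]

lemma tq_pos : 0 < tq Fq := by
  have : (0 : ℝ) < Fintype.card Fq := by exact_mod_cast Fintype.card_pos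
  rw [tq]
  positivity

lemma tq_le_one : tq Fq ≤ 1 := by
  rw [tq]
  apply inv_le_one_of_one_le₀
  rw [Real.one_le_sqrt]
  exact_mod_cast Fintype.card_pos

lemma LhalfR_eq (P : Fq[X]) : LhalfR P = ∑ m ∈ Finset.range P.natDegree,
    (∑ f ∈ monDeg Fq m, (jacobi P f : ℝ)) * tq Fq ^ m := by
  rw [LhalfR]
  refine Finset.sum_congr rfl fun m _ => ?_
  rw [← coe_monDeg, finsum_mem_coe_finset]
  rfl

/-- The sign relating `(P/f)` and `(f/P)` for `f` of odd degree. -/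
noncomputable def recSign (Fq : Type) [Field Fq] [Fintype Fq] (n : ℕ) : ℤ :=
  quadraticChar Fq (-1) ^ n

lemma recSign_sq (n : ℕ) : recSign Fq n ^ 2 = 1 := by
  rw [recSign, ← pow_mul, mul_comm, pow_mul,
    quadraticChar_sq_one (neg_ne_zero.mpr one_ne_zero), one_pow]

lemma recSign_even {n : ℕ} (hn : Even n) : recSign Fq n = 1 := by
  obtain ⟨k, rfl⟩ := hn
  rw [recSign, ← two_mul, pow_mul, quadraticChar_sq_one (neg_ne_zero.mpr one_ne_zero), one_pow]

lemma sum_jacobi (h2 : ringChar Fq ≠ 2) {P : Fq[X]} (hP : Irreducible P) (hm : P.Monic) (m : ℕ) :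
    ∑ f ∈ monDeg Fq m, (jacobi P f : ℝ) = (recSign Fq P.natDegree : ℝ) ^ m * aSum P m := by
  rw [aSum, Int.cast_sum, Finset.mul_sum]
  refine Finset.sum_congr rfl fun f hf => ?_
  rw [mem_monDeg] at hf
  rw [jacobi_reciprocity h2 hP hm hf.1, hf.2, recSign]
  push_cast
  rfl

lemma sum_range_symm {c : ℕ → ℝ} {g : ℕ} (h : ∀ m ≤ 2 * g, c (2 * g - m) = c m) :
    ∑ m ∈ Finset.range (2 * g + 1), c m = 2 * ∑ m ∈ Finset.range g, c m + c g := by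
  have e : 2 * g + 1 = (g + 1) + g := by ring
  rw [e, Finset.sum_range_add, Finset.sum_range_succ,
    ← Finset.sum_range_reflect (fun x => c (g + 1 + x))]
  have : ∀ j ∈ Finset.range g, c (g + 1 + (g - 1 - j)) = c j := by
    intro j hj
    rw [Finset.mem_range] at hj
    rw [← h j (by omega)]
    congr 1
    omega
  rw [Finset.sum_congr rfl this]
  ring

lemma LhalfR_odd (h2 : ringChar Fq ≠ 2) {P : Fq[X]} (hP : Irreducible P) (hm : P.Monic) {g : ℕ}
    (hn : P.natDegree = 2 * g + 1) : LhalfR P = ∑ j ∈ Finset.range (g + 1),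
      (if j < g then 2 else 1) * ((∑ f ∈ monDeg Fq j, (jacobi P f : ℝ)) * tq Fq ^ j) := by
  have ht := tq_pos (Fq := Fq)
  have htq := tq_sq (Fq := Fq)
  rw [LhalfR_eq, hn, sum_range_symm, Finset.sum_range_succ, if_neg (lt_irrefl g), one_mul,
    Finset.mul_sum]
  · congr 1
    refine Finset.sum_congr rfl fun j hj => ?_
    rw [if_pos (Finset.mem_range.mp hj)]
  · intro m hmg
    have hf := aSum_functional_odd h2 hP hm hn hmg
    have hf' : (Fintype.card Fq : ℝ) ^ g * aSum P m =
        (Fintype.card Fq : ℝ) ^ m * aSum P (2 * g - m) := by exact_mod_cast hf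
    rw [sum_jacobi h2 hP hm, sum_jacobi h2 hP hm]
    have hs : (recSign Fq P.natDegree : ℝ) ^ (2 * g - m) = (recSign Fq P.natDegree : ℝ) ^ m := by
      have h1 : (recSign Fq P.natDegree : ℝ) ^ 2 = 1 := by exact_mod_cast recSign_sq _
      have h3 : (recSign Fq P.natDegree : ℝ) ^ (2 * g - m) * (recSign Fq P.natDegree : ℝ) ^ m *
          (recSign Fq P.natDegree : ℝ) ^ m = (recSign Fq P.natDegree : ℝ) ^ m := by
        rw [← pow_add, Nat.sub_add_cancel hmg, pow_mul, h1, one_pow, one_mul]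
      rw [mul_assoc, ← pow_add, ← two_mul, pow_mul, h1, one_pow, mul_one] at h3
      exact h3
    rw [hs]
    have e1 : (tq Fq ^ (2 * g - m)) * tq Fq ^ m = tq Fq ^ (2 * g) := by
      rw [← pow_add, Nat.sub_add_cancel hmg]
    have e2 : tq Fq ^ (2 * g) * (Fintype.card Fq : ℝ) ^ g = 1 := by
      rw [pow_mul, ← mul_pow, htq, one_pow]
    have e3 : tq Fq ^ (2 * m) * (Fintype.card Fq : ℝ) ^ m = 1 := by
      rw [pow_mul, ← mul_pow, htq, one_pow]
    have e4 : tq Fq ^ (2 * m) = tq Fq ^ m * tq Fq ^ m := by rw [two_mul, pow_add]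
    rw [e4] at e3
    have e5 : (aSum P (2 * g - m) : ℝ) * tq Fq ^ (2 * g - m) = aSum P m * tq Fq ^ m := by
      have hne : (tq Fq ^ m) ≠ 0 := (pow_pos ht m).ne'
      apply mul_right_cancel₀ hne
      linear_combination (aSum P (2 * g - m) : ℝ) * e1 + (aSum P m : ℝ) * tq Fq ^ m * tq Fq ^ m * e2
        - aSum P (2 * g - m) * tq Fq ^ (2 * g) * e3 - tq Fq ^ m * tq Fq ^ m * tq Fq ^ (2 * g) * hf'
    linear_combination (recSign Fq P.natDegree : ℝ) ^ m * e5

lemma sum_range_abel (a : ℕ → ℝ) (t : ℝ) (G : ℕ) :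
    (1 - t) * ∑ s ∈ Finset.range G, (∑ j ∈ Finset.range (s + 1), a j) * t ^ s =
      ∑ j ∈ Finset.range G, a j * t ^ j - (∑ j ∈ Finset.range G, a j) * t ^ G := by
  induction G with
  | zero => simp
  | succ G ih =>
    simp only [Finset.sum_range_succ] at ih ⊢
    rw [mul_add, ih]
    ring

lemma LhalfR_even (h2 : ringChar Fq ≠ 2) {P : Fq[X]} (hP : Irreducible P) (hm : P.Monic) {g : ℕ}
    (hn : P.natDegree = 2 * g + 2) : LhalfR P = ∑ j ∈ Finset.range (g + 1),
      (2 - (1 + tq Fq) * tq Fq ^ (g - j)) *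
        ((∑ f ∈ monDeg Fq j, (jacobi P f : ℝ)) * tq Fq ^ j) := by
  have ht := tq_pos (Fq := Fq)
  have htq := tq_sq (Fq := Fq)
  have heven : Even P.natDegree := ⟨g + 1, by omega⟩
  have hj : ∀ m, ∑ f ∈ monDeg Fq m, (jacobi P f : ℝ) = aSum P m := by
    intro m
    rw [sum_jacobi h2 hP hm, recSign_even heven]
    simp
  simp only [LhalfR_eq, hj, hn]
  set a : ℕ → ℝ := fun j => (aSum P j : ℝ) with ha
  have hb : ∀ s, (bSum P s : ℝ) = ∑ j ∈ Finset.range s, a j := by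
    intro s
    rw [bSum, Int.cast_sum]
  have h0 : ∑ j ∈ Finset.range (2 * g + 2), a j = 0 := by
    rw [← hb, ← hn, bSum_natDegree_even h2 hP hm heven, Int.cast_zero]
  have hA := sum_range_abel a (tq Fq) (2 * g + 2)
  rw [h0, zero_mul, sub_zero, Finset.sum_range_succ, h0, zero_mul, add_zero,
    sum_range_symm] at hA
  · have hB := sum_range_abel a (tq Fq) g
    have e : ∀ j ∈ Finset.range (g + 1), (2 - (1 + tq Fq) * tq Fq ^ (g - j)) * (a j * tq Fq ^ j) =
        2 * (a j * tq Fq ^ j) - (1 + tq Fq) * tq Fq ^ g * a j := by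
      intro j hj
      rw [Finset.mem_range] at hj
      have : tq Fq ^ (g - j) * tq Fq ^ j = tq Fq ^ g := by
        rw [← pow_add, Nat.sub_add_cancel (by omega)]
      linear_combination -(1 + tq Fq) * a j * this
    rw [Finset.sum_congr rfl e, Finset.sum_sub_distrib, ← Finset.mul_sum, ← Finset.mul_sum,
      ← hA, mul_add]
    rw [Finset.sum_range_succ a, Finset.sum_range_succ fun i => a i * tq Fq ^ i]
    linear_combination 2 * hB
  · intro m hmg
    have hf := bSum_functional_even h2 hP hm hn (m := m + 1) (by omega)
    have e0 : 2 * g + 2 - (m + 1) = 2 * g - m + 1 := by omega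
    rw [e0] at hf
    have hf' : (Fintype.card Fq : ℝ) ^ (g + 1) * bSum P (m + 1) =
        (Fintype.card Fq : ℝ) ^ (m + 1) * bSum P (2 * g - m + 1) := by exact_mod_cast hf
    rw [← hb, ← hb]
    have hq0 : (Fintype.card Fq : ℝ) ≠ 0 := by exact_mod_cast Fintype.card_ne_zero
    rw [pow_succ, pow_succ] at hf'
    have hf'' : (Fintype.card Fq : ℝ) ^ g * bSum P (m + 1) =
        (Fintype.card Fq : ℝ) ^ m * bSum P (2 * g - m + 1) := by
      apply mul_left_cancel₀ hq0
      linear_combination hf'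
    have e1 : (tq Fq ^ (2 * g - m)) * tq Fq ^ m = tq Fq ^ (2 * g) := by
      rw [← pow_add, Nat.sub_add_cancel hmg]
    have e2 : tq Fq ^ (2 * g) * (Fintype.card Fq : ℝ) ^ g = 1 := by
      rw [pow_mul, ← mul_pow, htq, one_pow]
    have e3 : tq Fq ^ (2 * m) * (Fintype.card Fq : ℝ) ^ m = 1 := by
      rw [pow_mul, ← mul_pow, htq, one_pow]
    have e4 : tq Fq ^ (2 * m) = tq Fq ^ m * tq Fq ^ m := by rw [two_mul, pow_add]
    rw [e4] at e3
    have hne : (tq Fq ^ m) ≠ 0 := (pow_pos ht m).ne'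
    apply mul_right_cancel₀ hne
    linear_combination (bSum P (2 * g - m + 1) : ℝ) * e1 +
      (bSum P (m + 1) : ℝ) * tq Fq ^ m * tq Fq ^ m * e2
      - bSum P (2 * g - m + 1) * tq Fq ^ (2 * g) * e3
      - tq Fq ^ m * tq Fq ^ m * tq Fq ^ (2 * g) * hf''

/-- The central value as a short Dirichlet polynomial with weights depending only on the degree. -/
lemma exists_weights (h2 : ringChar Fq ≠ 2) {n : ℕ} (hn : 0 < n) : ∃ w : ℕ → ℝ,
    (∀ j ≤ (n - 1) / 2, 0 ≤ w j ∧ w j ≤ 2) ∧ (∀ j, j + 2 ≤ (n - 1) / 2 → 1 ≤ w j) ∧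
    ∀ P : Fq[X], Irreducible P → P.Monic → P.natDegree = n →
      LhalfR P = ∑ j ∈ Finset.range ((n - 1) / 2 + 1),
        w j * ((∑ f ∈ monDeg Fq j, (jacobi P f : ℝ)) * tq Fq ^ j) := by
  have ht := tq_pos (Fq := Fq)
  have ht1 := tq_le_one (Fq := Fq)
  obtain ⟨g, rfl | rfl⟩ : ∃ g, n = 2 * g + 1 ∨ n = 2 * g + 2 := ⟨(n - 1) / 2, by omega⟩
  · have e : (2 * g + 1 - 1) / 2 = g := by omega
    rw [e]
    refine ⟨fun j => if j < g then 2 else 1, fun j _ => ?_, fun j hj => ?_,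
      fun P hP hm hPn => LhalfR_odd h2 hP hm hPn⟩
    · dsimp only
      split_ifs <;> norm_num
    · dsimp only
      rw [if_pos (by omega)]
      norm_num
  · have e : (2 * g + 2 - 1) / 2 = g := by omega
    rw [e]
    refine ⟨fun j => 2 - (1 + tq Fq) * tq Fq ^ (g - j), fun j _ => ⟨?_, ?_⟩, fun j hj => ?_,
      fun P hP hm hPn => LhalfR_even h2 hP hm hPn⟩
    · have := pow_le_one₀ ht.le ht1 (n := g - j)
      have h0 := pow_pos ht (g - j)
      nlinarith
    · have h0 := pow_pos ht (g - j)
      have : 0 < (1 + tq Fq) * tq Fq ^ (g - j) := by positivity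
      linarith
    · have h1 : tq Fq ^ (g - j) ≤ tq Fq ^ 2 := pow_le_pow_of_le_one ht.le ht1 (by omega)
      have h3 : tq Fq ^ 2 ≤ 1 / 2 := by
        have hq : (2 : ℝ) ≤ Fintype.card Fq := by exact_mod_cast Fintype.one_lt_card
        have := tq_sq (Fq := Fq)
        nlinarith [sq_nonneg (tq Fq)]
      have h0 := pow_pos ht (g - j)
      nlinarith

/-- Monic irreducible polynomials of degree `n`. -/
noncomputable def irrDeg (Fq : Type) [Field Fq] [Fintype Fq] (n : ℕ) : Finset Fq[X] :=
  (monDeg Fq n).filter Irreducible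

lemma mem_irrDeg {n : ℕ} {P : Fq[X]} :
    P ∈ irrDeg Fq n ↔ P.Monic ∧ Irreducible P ∧ P.natDegree = n := by
  rw [irrDeg, Finset.mem_filter, mem_monDeg]
  tauto

lemma coe_irrDeg (n : ℕ) : (irrDeg Fq n : Set Fq[X]) =
    {P : Fq[X] | P.Monic ∧ Irreducible P ∧ P.natDegree = n} := by
  ext f
  simp [mem_irrDeg]

lemma card_dvd_ringChar : ringChar Fq ∣ Fintype.card Fq := by
  rw [← CharP.cast_eq_zero_iff Fq (ringChar Fq)]
  exact FiniteField.cast_card_eq_zero Fq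

lemma card_pow_le_irrDeg {n : ℕ} (hn : 0 < n) : Fintype.card Fq ^ n ≤
    n * (irrDeg Fq n).card + ∑ e ∈ Finset.Icc 1 (n / 2), Fintype.card Fq ^ e := by
  set q := Fintype.card Fq with hq
  have hq1 : 1 < q := Fintype.one_lt_card
  let Ω := AlgebraicClosure Fq
  have hsep : ∀ e, e ≠ 0 → (X ^ q ^ e - X : Fq[X]).Separable := fun e he =>
    galois_poly_separable (ringChar Fq) _ (card_dvd_ringChar.trans (dvd_pow_self _ he))
  let R : Fq[X] → Finset Ω := fun f => (f.map (algebraMap Fq Ω)).roots.toFinset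
  have hR : ∀ f : Fq[X], (R f).card ≤ f.natDegree := fun f =>
    (Multiset.toFinset_card_le _).trans ((card_roots' _).trans natDegree_map_le)
  have hRmem : ∀ {f : Fq[X]}, f ≠ 0 → ∀ {a : Ω}, a ∈ R f ↔ aeval a f = 0 := by
    intro f hf a
    rw [Multiset.mem_toFinset, mem_roots (map_ne_zero hf), IsRoot.def, eval_map_algebraMap]
  have hne : ∀ e, e ≠ 0 → (X ^ q ^ e - X : Fq[X]) ≠ 0 := fun e he =>
    FiniteField.X_pow_card_pow_sub_X_ne_zero Fq he hq1
  have hdeg : ∀ e, e ≠ 0 → (X ^ q ^ e - X : Fq[X]).natDegree = q ^ e := fun e he =>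
    FiniteField.X_pow_card_pow_sub_X_natDegree_eq Fq he hq1
  have hcard : (R (X ^ q ^ n - X)).card = q ^ n := by
    rw [Multiset.toFinset_card_of_nodup (nodup_roots (hsep n hn.ne').map),
      IsAlgClosed.card_roots_eq_natDegree, natDegree_map, hdeg n hn.ne']
  have hsub : R (X ^ q ^ n - X) ⊆ (irrDeg Fq n).biUnion R ∪
      (Finset.Icc 1 (n / 2)).biUnion fun e => R (X ^ q ^ e - X) := by
    intro a ha
    rw [hRmem (hne n hn.ne')] at ha
    have haint : IsIntegral Fq a := ⟨_, monic_X_pow_sub (by rw [degree_X]; exact_mod_cast Nat.one_lt_pow hn.ne' hq1), by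
      simpa [aeval_def] using ha⟩
    have hirr := minpoly.irreducible haint
    have hd := minpoly.dvd Fq a ha
    rw [hq, ← Nat.card_eq_fintype_card, ← hirr.natDegree_dvd_iff_dvd_X_pow_card_pow_sub_X] at hd
    have hpos := hirr.natDegree_pos
    rw [Finset.mem_union, Finset.mem_biUnion, Finset.mem_biUnion]
    by_cases he : (minpoly Fq a).natDegree = n
    · refine Or.inl ⟨minpoly Fq a, mem_irrDeg.mpr ⟨minpoly.monic haint, hirr, he⟩, ?_⟩
      rw [hRmem hirr.ne_zero, minpoly.aeval]
    · refine Or.inr ⟨(minpoly Fq a).natDegree, Finset.mem_Icc.mpr ⟨hpos, ?_⟩, ?_⟩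
      · obtain ⟨k, hk⟩ := hd
        rw [Nat.le_div_iff_mul_le two_pos, hk]
        refine Nat.mul_le_mul_left _ ?_
        rcases k with _ | _ | k
        · omega
        · omega
        · omega
      · rw [hRmem (hne _ hpos.ne')]
        have h3 : minpoly Fq a ∣ X ^ q ^ (minpoly Fq a).natDegree - X := by
          rw [hq, ← Nat.card_eq_fintype_card, ← hirr.natDegree_dvd_iff_dvd_X_pow_card_pow_sub_X]
        exact aeval_eq_zero_of_dvd_aeval_eq_zero h3 (minpoly.aeval Fq a)
  calc q ^ n = (R (X ^ q ^ n - X)).card := hcard.symm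
    _ ≤ _ := Finset.card_le_card hsub
    _ ≤ _ := Finset.card_union_le _ _
    _ ≤ ∑ P ∈ irrDeg Fq n, (R P).card + ∑ e ∈ Finset.Icc 1 (n / 2), (R (X ^ q ^ e - X)).card :=
      add_le_add Finset.card_biUnion_le Finset.card_biUnion_le
    _ ≤ _ := by
      refine add_le_add ?_ (Finset.sum_le_sum fun e he => ?_)
      · rw [mul_comm, ← smul_eq_mul, ← Finset.sum_const]
        exact Finset.sum_le_sum fun P hP => (hR P).trans (mem_irrDeg.mp hP).2.2.le
      · rw [Finset.mem_Icc] at he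
        exact (hR _).trans (hdeg e (by omega)).le

lemma sum_card_pow_le (N : ℕ) :
    ∑ e ∈ Finset.Icc 1 N, Fintype.card Fq ^ e ≤ 2 * Fintype.card Fq ^ N := by
  have hq1 : 2 ≤ Fintype.card Fq := Fintype.one_lt_card
  induction N with
  | zero => simp
  | succ N ih =>
    rw [Finset.sum_Icc_succ_top (by omega), pow_succ]
    nlinarith [Nat.mul_le_mul_left (Fintype.card Fq ^ N) hq1]

lemma card_pow_le_irrDeg' {n : ℕ} (hn : 0 < n) : Fintype.card Fq ^ n ≤
    n * (irrDeg Fq n).card + 2 * Fintype.card Fq ^ (n / 2) :=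
  (card_pow_le_irrDeg hn).trans (Nat.add_le_add_left (sum_card_pow_le _) _)

lemma expand_card_pow (N : ℕ) (f : Fq[X]) :
    expand Fq (Fintype.card Fq ^ N) f = f ^ Fintype.card Fq ^ N := by
  induction N with
  | zero => simp
  | succ N ih => rw [pow_succ, expand_mul, FiniteField.expand_card, map_pow, ih, ← pow_mul]

lemma sub_pow_card_pow (N : ℕ) (f g : Fq[X]) :
    (f - g) ^ Fintype.card Fq ^ N = f ^ Fintype.card Fq ^ N - g ^ Fintype.card Fq ^ N := by
  simp only [← expand_card_pow, map_sub]

lemma sum_pow_card_pow {ι : Type*} (N : ℕ) (s : Finset ι) (f : ι → Fq[X]) :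
    (∑ i ∈ s, f i) ^ Fintype.card Fq ^ N = ∑ i ∈ s, f i ^ Fintype.card Fq ^ N := by
  simp only [← expand_card_pow, map_sum]

lemma sub_mem_lowDeg {m : ℕ} {f g : Fq[X]} (hf : f ∈ lowDeg Fq m) (hg : g ∈ lowDeg Fq m) :
    f - g ∈ lowDeg Fq m := by
  rw [sub_eq_add_neg]
  exact add_mem_lowDeg hf (neg_mem_lowDeg hg)

lemma mem_lowDeg_of_natDegree_lt {m : ℕ} {f : Fq[X]} (h : f.natDegree < m) : f ∈ lowDeg Fq m := by
  rw [mem_lowDeg]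
  exact lt_of_le_of_lt degree_le_natDegree (by exact_mod_cast h)

lemma natDegree_lt_of_mem_lowDeg {m : ℕ} (hm : 0 < m) {f : Fq[X]} (h : f ∈ lowDeg Fq m) :
    f.natDegree < m := by
  rw [mem_lowDeg] at h
  by_cases h0 : f = 0
  · simpa [h0] using hm
  · rw [degree_eq_natDegree h0] at h
    exact_mod_cast h

lemma sum_mem_lowDeg {ι : Type*} {m : ℕ} (s : Finset ι) (f : ι → Fq[X])
    (h : ∀ i ∈ s, f i ∈ lowDeg Fq m) : ∑ i ∈ s, f i ∈ lowDeg Fq m :=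
  Finset.sum_induction _ (· ∈ lowDeg Fq m) (fun _ _ => add_mem_lowDeg) (zero_mem_lowDeg m) h

/-- A vanishing statement for polynomials close to a power of a nonsquare. -/
lemma eq_zero_of_X_pow_dvd {N : ℕ} {f A B : Fq[X]} (hfm : f.Monic) (hf : ¬ IsSquare f)
    (hX : ¬ X ^ 2 ∣ f) {L a b : ℕ} (hL : L = Fintype.card Fq ^ N) (hodd : L + 1 = 2 * a)
    (hb : b + f.natDegree = a) (hA : A ∈ lowDeg Fq a) (hB : B ∈ lowDeg Fq b)
    (h : X ^ L ∣ A + B * f ^ a) : A = 0 ∧ B = 0 := by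
  have hapos : 0 < a := by omega
  have hd : 0 < f.natDegree := by
    rw [Nat.pos_iff_ne_zero]
    intro h0
    exact hf (hfm.natDegree_eq_zero.mp h0 ▸ IsSquare.one)
  have hfL : X ^ L ∣ f ^ L - C (f.coeff 0) := by
    have e : expand Fq L f = f ^ L := by rw [hL]; exact expand_card_pow N f
    rw [← e]
    have h1 : X ∣ f - C (f.coeff 0) := by
      rw [X_dvd_iff]
      simp
    have h2 := map_dvd (expand Fq L) h1
    rwa [expand_X, map_sub, expand_C] at h2
  have h1 : X ^ L ∣ A ^ 2 - B ^ 2 * f ^ (2 * a) := by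
    have : A ^ 2 - B ^ 2 * f ^ (2 * a) = (A + B * f ^ a) * (A - B * f ^ a) := by ring
    rw [this]
    exact h.mul_right _
  have h3 : X ^ L ∣ A ^ 2 - C (f.coeff 0) * (B * B * f) := by
    have h4 : X ^ L ∣ (f ^ L - C (f.coeff 0)) * (B * B * f) := hfL.mul_right _
    rw [← hodd] at h1
    convert h1.add h4 using 1
    ring
  have h5 : A ^ 2 - C (f.coeff 0) * (B * B * f) ∈ lowDeg Fq L := by
    refine sub_mem_lowDeg ?_ (C_mul_mem_lowDeg _ ?_)
    · rw [pow_two]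
      exact mul_mem_lowDeg hA hA (by omega)
    · refine mul_mem_lowDeg (mul_mem_lowDeg hB hB (c := 2 * b) (by omega))
        (mem_lowDeg_of_natDegree_lt (Nat.lt_succ_self f.natDegree)) (by omega)
  have h6 : A ^ 2 = C (f.coeff 0) * (B * B * f) := by
    rw [← sub_eq_zero]
    apply eq_zero_of_dvd_of_mem_lowDeg (monic_X_pow L) _ h3
    rwa [natDegree_X_pow]
  by_cases hc : f.coeff 0 = 0
  · have hA0 : A = 0 := by
      rw [hc, C_0, zero_mul] at h6
      exact pow_eq_zero_iff two_ne_zero |>.mp h6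
    refine ⟨hA0, ?_⟩
    obtain ⟨f0, hf0⟩ := X_dvd_iff.mpr hc
    have hX0 : ¬ X ∣ f0 := by
      rintro ⟨f1, rfl⟩
      exact hX ⟨f1, by rw [hf0]; ring⟩
    rw [hA0, zero_add, hf0, mul_pow] at h
    have h7 : X ^ (a - 1) ∣ B := by
      have e : L = a + (a - 1) := by omega
      rw [e, pow_add, mul_left_comm] at h
      have h8 := (mul_dvd_mul_iff_left (pow_ne_zero a (X_ne_zero (R := Fq)))).mp h
      refine (IsCoprime.pow ?_).dvd_of_dvd_mul_right h8
      exact (irreducible_X.coprime_iff_not_dvd).mpr hX0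
    apply eq_zero_of_dvd_of_mem_lowDeg (monic_X_pow (a - 1)) _ h7
    rw [natDegree_X_pow]
    exact mem_lowDeg_mono (by omega) hB
  · by_cases hB0 : B = 0
    · refine ⟨?_, hB0⟩
      rw [hB0, zero_mul, zero_mul, mul_zero] at h6
      exact pow_eq_zero_iff two_ne_zero |>.mp h6
    exfalso
    have h7 : B ^ 2 ∣ A ^ 2 := ⟨C (f.coeff 0) * f, by rw [h6]; ring⟩
    obtain ⟨D, rfl⟩ := (IsIntegrallyClosed.pow_dvd_pow_iff two_ne_zero).mp h7
    have h8 : D ^ 2 = C (f.coeff 0) * f := by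
      apply mul_left_cancel₀ (pow_ne_zero 2 hB0)
      linear_combination h6
    have h9 : D.leadingCoeff ^ 2 = f.coeff 0 := by
      have := congrArg leadingCoeff h8
      rwa [leadingCoeff_pow, leadingCoeff_mul, leadingCoeff_C, hfm.leadingCoeff, mul_one] at this
    have hD0 : D.leadingCoeff ≠ 0 := by
      intro h0
      rw [h0] at h9
      exact hc (by simpa using h9.symm)
    refine hf ⟨C (D.leadingCoeff)⁻¹ * D, ?_⟩
    have h10 : C (D.leadingCoeff)⁻¹ ^ 2 * C (f.coeff 0) = 1 := by
      rw [← h9, ← C_pow, ← C_mul, ← mul_pow, inv_mul_cancel₀ hD0, one_pow, C_1]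
    linear_combination -(C (D.leadingCoeff)⁻¹ ^ 2) * h8 - f * h10

lemma eq_zero_of_sum_X_pow {L : ℕ} (J : ℕ) (G : ℕ → Fq[X])
    (h : ∀ j < J, X ^ L ∣ G j → G j = 0)
    (hs : ∑ j ∈ Finset.range J, G j * X ^ (j * L) = 0) : ∀ j < J, G j = 0 := by
  induction J generalizing G with
  | zero => intro j hj; omega
  | succ J ih =>
    rw [Finset.sum_range_succ'] at hs
    have e : ∑ j ∈ Finset.range J, G (j + 1) * X ^ ((j + 1) * L) =
        X ^ L * ∑ j ∈ Finset.range J, G (j + 1) * X ^ (j * L) := by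
      rw [Finset.mul_sum]
      exact Finset.sum_congr rfl fun j _ => by ring
    rw [e, zero_mul, pow_zero, mul_one] at hs
    have h0 : G 0 = 0 := h 0 (Nat.succ_pos J) ⟨-∑ j ∈ Finset.range J, G (j + 1) * X ^ (j * L), by
      linear_combination hs⟩
    rw [h0, add_zero] at hs
    have h1 := (mul_eq_zero.mp hs).resolve_left (pow_ne_zero L X_ne_zero)
    have := ih (fun j => G (j + 1)) (fun j hj => h (j + 1) (by omega)) h1
    intro j hj
    rcases j with _ | j
    · exact h0
    · exact this j (by omega)

/-- Existence of the auxiliary polynomial coefficients. -/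
lemma exists_auxiliary {N₁ : ℕ} {f : Fq[X]} (ε : Fq) (M a b J : ℕ)
    (hM : M = Fintype.card Fq ^ N₁) (e : ℕ) (hdeg : M * b + f.natDegree * e ≤ M * a)
    (hbpos : 0 < b) (ha : 0 < a) (hJ : M * (a - 1) + J < J * (a + b)) :
    ∃ A B : ℕ → Fq[X], (∀ j, A j ∈ lowDeg Fq a) ∧ (∀ j, B j ∈ lowDeg Fq b) ∧
      (∃ j < J, A j ≠ 0 ∨ B j ≠ 0) ∧
      ∑ j ∈ Finset.range J, (A j ^ M + C ε * B j ^ M * f ^ e) * X ^ j = 0 := by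
  set F : (Fin J → Fq[X]) × (Fin J → Fq[X]) → Fq[X] := fun p =>
    ∑ j : Fin J, (p.1 j ^ M + C ε * p.2 j ^ M * f ^ e) * X ^ (j : ℕ) with hF
  set S := Fintype.piFinset (fun _ : Fin J => lowDeg Fq a) ×ˢ
    Fintype.piFinset (fun _ : Fin J => lowDeg Fq b) with hS
  have hcard : (lowDeg Fq (M * (a - 1) + J)).card < S.card := by
    rw [hS, Finset.card_product, Fintype.card_piFinset, Fintype.card_piFinset]
    simp only [card_lowDeg, Finset.prod_const, Finset.card_univ, Fintype.card_fin]
    rw [← pow_mul, ← pow_mul, ← pow_add]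
    apply Nat.pow_lt_pow_right Fintype.one_lt_card
    linarith [Nat.mul_add J a b, mul_comm J a, mul_comm J b]
  have hMpos : 0 < M := hM ▸ Nat.pow_pos Fintype.card_pos
  have hmaps : ∀ p ∈ S, F p ∈ lowDeg Fq (M * (a - 1) + J) := by
    intro p hp
    rw [hS, Finset.mem_product, Fintype.mem_piFinset, Fintype.mem_piFinset] at hp
    refine sum_mem_lowDeg _ _ fun j _ => ?_
    have h1 := natDegree_lt_of_mem_lowDeg ha (hp.1 j)
    have h2 := natDegree_lt_of_mem_lowDeg hbpos (hp.2 j)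
    have hX : (X ^ (j : ℕ) : Fq[X]) ∈ lowDeg Fq J := X_pow_mem_lowDeg j.2
    refine mul_mem_lowDeg (a := M * (a - 1) + 1) (add_mem_lowDeg ?_ ?_) hX (by omega)
    · apply mem_lowDeg_of_natDegree_lt
      rw [natDegree_pow, Nat.lt_succ_iff]
      exact Nat.mul_le_mul_left M (by omega)
    · rw [mul_assoc]
      apply C_mul_mem_lowDeg
      apply mem_lowDeg_of_natDegree_lt
      rw [Nat.lt_succ_iff]
      refine natDegree_mul_le.trans ?_
      rw [natDegree_pow, natDegree_pow]
      have h3 : M * (p.2 j).natDegree ≤ M * (b - 1) := Nat.mul_le_mul_left M (by omega)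
      have h4 : M * (b - 1) + M = M * b := by
        rw [← Nat.mul_succ, Nat.succ_eq_add_one, Nat.sub_add_cancel hbpos]
      have h5 : M * (a - 1) + M = M * a := by
        rw [← Nat.mul_succ, Nat.succ_eq_add_one, Nat.sub_add_cancel ha]
      rw [mul_comm e]
      omega
  obtain ⟨p, hp, p', hp', hne, heq⟩ := Finset.exists_ne_map_eq_of_card_lt_of_maps_to hcard hmaps
  rw [hS, Finset.mem_product, Fintype.mem_piFinset, Fintype.mem_piFinset] at hp hp'
  refine ⟨fun j => if h : j < J then p.1 ⟨j, h⟩ - p'.1 ⟨j, h⟩ else 0,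
    fun j => if h : j < J then p.2 ⟨j, h⟩ - p'.2 ⟨j, h⟩ else 0, fun j => ?_, fun j => ?_, ?_, ?_⟩
  · dsimp only
    split_ifs with h
    · exact sub_mem_lowDeg (hp.1 _) (hp'.1 _)
    · exact zero_mem_lowDeg a
  · dsimp only
    split_ifs with h
    · exact sub_mem_lowDeg (hp.2 _) (hp'.2 _)
    · exact zero_mem_lowDeg b
  · by_contra hcon
    push Not at hcon
    apply hne
    refine Prod.ext (funext fun j => ?_) (funext fun j => ?_)
    · have := (hcon j j.2).1
      rw [dif_pos j.2] at this
      exact sub_eq_zero.mp this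
    · have := (hcon j j.2).2
      rw [dif_pos j.2] at this
      exact sub_eq_zero.mp this
  · rw [Finset.sum_range]
    have h0 : F p - F p' = 0 := sub_eq_zero.mpr heq
    rw [hF] at h0
    dsimp only at h0
    rw [← Finset.sum_sub_distrib] at h0
    refine Eq.trans (Finset.sum_congr rfl fun j _ => ?_) h0
    dsimp only
    rw [dif_pos j.2, dif_pos j.2, hM, sub_pow_card_pow, sub_pow_card_pow]
    ring

lemma X_pow_card_sub_X_dvd {n : ℕ} {P : Fq[X]} (hP : P ∈ irrDeg Fq n) :
    P ∣ X ^ (Fintype.card Fq ^ n) - X := by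
  rw [mem_irrDeg] at hP
  have := (hP.2.1.natDegree_dvd_iff_dvd_X_pow_card_pow_sub_X (n := n)).mp (by rw [hP.2.2])
  simpa [Nat.card_eq_fintype_card] using this

lemma card_mul_le_natDegree {n : ℕ} {s : Finset Fq[X]} (hs : s ⊆ irrDeg Fq n) {H : Fq[X]}
    (hH : H ≠ 0) (h : ∀ P ∈ s, P ∣ H) : s.card * n ≤ H.natDegree := by
  have h1 : ∏ P ∈ s, P ∣ H := by
    refine Finset.prod_dvd_of_coprime ?_ h
    intro P hP R hR hne
    have hP' := mem_irrDeg.mp (hs hP)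
    have hR' := mem_irrDeg.mp (hs hR)
    refine (hP'.2.1.coprime_iff_not_dvd).mpr fun hd => hne ?_
    exact eq_of_monic_of_associated hP'.1 hR'.1 ((hP'.2.1.dvd_irreducible_iff_associated hR'.2.1).mp hd)
  have h2 := natDegree_le_of_dvd h1 hH
  rw [natDegree_prod_of_monic _ _ fun P hP => (mem_irrDeg.mp (hs hP)).1,
    Finset.sum_congr rfl fun P hP => (mem_irrDeg.mp (hs hP)).2.2, Finset.sum_const,
    smul_eq_mul] at h2
  exact h2

set_option maxHeartbeats 800000 in
/-- Stepanov's bound for the number of primes with a prescribed quadratic symbol. -/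
lemma card_quadCharP_eq_le (h2 : ringChar Fq ≠ 2) {f : Fq[X]} (hfm : f.Monic)
    (hf : ¬ IsSquare f) (hX : ¬ X ^ 2 ∣ f) (ε : ℤ) {N₁ N₂ : ℕ} (hN : N₁ ≤ N₂)
    (hd : 2 * f.natDegree < Fintype.card Fq ^ N₂) :
    2 * (((irrDeg Fq (N₁ + N₂)).filter (fun P => quadCharP f P = ε)).card * (N₁ + N₂)) ≤
      Fintype.card Fq ^ (N₁ + N₂) + (3 * f.natDegree + 2) * Fintype.card Fq ^ N₂ := by
  have hqodd := odd_card_of_ringChar_ne_two h2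
  obtain ⟨M, hM⟩ : ∃ M, M = Fintype.card Fq ^ N₁ := ⟨_, rfl⟩
  obtain ⟨L, hL⟩ : ∃ L, L = Fintype.card Fq ^ N₂ := ⟨_, rfl⟩
  have hML : M ≤ L := by
    rw [hM, hL]
    exact Nat.pow_le_pow_right Fintype.card_pos hN
  have hQ : Fintype.card Fq ^ (N₁ + N₂) = M * L := by rw [hM, hL, pow_add]
  obtain ⟨a₀, ha₀⟩ : Odd L := hL ▸ hqodd.pow
  obtain ⟨e₀, he₀⟩ : Odd M := hM ▸ hqodd.pow
  obtain ⟨d, hdd⟩ : ∃ d, d = f.natDegree := ⟨_, rfl⟩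
  rw [← hL, ← hdd] at hd
  have hd0 : 0 < d := by
    rw [hdd, Nat.pos_iff_ne_zero]
    intro h0
    exact hf (hfm.natDegree_eq_zero.mp h0 ▸ IsSquare.one)
  obtain ⟨b, hb⟩ : ∃ b, b + d = a₀ + 1 := ⟨a₀ + 1 - d, by omega⟩
  obtain ⟨J, hJ⟩ : ∃ J, J = e₀ + d + 2 := ⟨_, rfl⟩
  have hJineq : M * a₀ + J < J * (a₀ + 1 + b) := by
    have hb' : a₀ + 1 + b = L + 1 - d := by omega
    rw [hb', hJ]
    obtain ⟨t, ht⟩ : ∃ t, L = 2 * d + 1 + t := ⟨L - (2 * d + 1), by omega⟩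
    have : L + 1 - d = d + 2 + t := by omega
    rw [this]
    have h1 : M * (2 * a₀) = M * (2 * d + t) := by congr 1; omega
    have h3 : (M + 2 * d + 3) * (d + 1 + t) > M * (2 * d + t) := by
      have : M ≤ 2 * d + 1 + t := ht ▸ hML
      nlinarith
    have h4 : 2 * (e₀ + d + 2) = M + 2 * d + 3 := by omega
    nlinarith
  obtain ⟨A, B, hA, hB, ⟨j₀, hj₀, hne⟩, hsum⟩ := exists_auxiliary (N₁ := N₁) (f := f) (ε : Fq) M
    (a₀ + 1) b J hM (e₀ + 1) (by
      rw [← hdd, ← hb, mul_add M b d, mul_comm M d]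
      gcongr
      omega) (by omega) (by omega) hJineq
  set G : ℕ → Fq[X] := fun j => A j + B j * f ^ (a₀ + 1) with hG
  have hkey : ∀ j, X ^ L ∣ G j → A j = 0 ∧ B j = 0 := fun j hj =>
    eq_zero_of_X_pow_dvd hfm hf hX hL (by omega) (by rw [← hdd]; exact hb) (hA j) (hB j) hj
  set H : Fq[X] := ∑ j ∈ Finset.range J, G j * X ^ (j * L) with hH
  have hH0 : H ≠ 0 := by
    intro h0
    have h5 := eq_zero_of_sum_X_pow J G (fun j _ hj => by
      rw [hG]; dsimp only; rw [(hkey j hj).1, (hkey j hj).2]; simp) h0 j₀ hj₀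
    have h6 := hkey j₀ (h5 ▸ dvd_zero _)
    rcases hne with h | h
    · exact h h6.1
    · exact h h6.2
  have hdvd : ∀ P ∈ (irrDeg Fq (N₁ + N₂)).filter (fun P => quadCharP f P = ε), P ∣ H := by
    intro P hP
    rw [Finset.mem_filter] at hP
    have hPi := mem_irrDeg.mp hP.1
    apply hPi.2.1.prime.dvd_of_dvd_pow (n := M)
    have hXQ := X_pow_card_sub_X_dvd hP.1
    have hfQ := dvd_pow_sub_quadCharP hPi.2.1 h2 f
    rw [hPi.2.2, hP.2] at hfQ
    rw [← AdjoinRoot.mk_eq_mk, map_pow] at hfQ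
    rw [← AdjoinRoot.mk_eq_mk, map_pow] at hXQ
    rw [← AdjoinRoot.mk_eq_zero, hH, hM, sum_pow_card_pow, ← hM, map_sum,
      ← map_zero (AdjoinRoot.mk P), ← hsum, map_sum]
    refine Finset.sum_congr rfl fun j _ => ?_
    have e1 : (A j + B j * f ^ (a₀ + 1)) ^ M = A j ^ M + B j ^ M * f ^ ((a₀ + 1) * M) := by
      have := sum_pow_card_pow N₁ (Finset.univ : Finset (Fin 2)) ![A j, B j * f ^ (a₀ + 1)]
      rw [← hM] at this
      simpa [Fin.sum_univ_two, mul_pow, ← pow_mul] using this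
    have e2 : (a₀ + 1) * M = Fintype.card Fq ^ (N₁ + N₂) / 2 + (e₀ + 1) := by
      have : Fintype.card Fq ^ (N₁ + N₂) = 2 * (M * a₀ + e₀) + 1 := by
        rw [hQ, ha₀]
        linear_combination he₀
      rw [this]
      have h7 : (2 * (M * a₀ + e₀) + 1) / 2 = M * a₀ + e₀ := by omega
      rw [h7, he₀]
      ring
    have e3 : (X : Fq[X]) ^ (j * L * M) = (X ^ (Fintype.card Fq ^ (N₁ + N₂))) ^ j := by
      rw [← pow_mul, hQ]
      congr 1
      ring
    rw [mul_pow, hG]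
    dsimp only
    rw [e1, e2, ← pow_mul, e3]
    simp only [map_mul, map_add, map_pow, hXQ]
    rw [pow_add, hfQ]
    simp only [map_intCast]
    ring
  have hdeg : H.natDegree ≤ (b + d * (a₀ + 1)) + (J - 1) * L - 1 := by
    rw [Nat.le_sub_one_iff_lt (by positivity)]
    refine natDegree_lt_of_mem_lowDeg (by positivity) (sum_mem_lowDeg _ _ fun j hj => ?_)
    rw [Finset.mem_range] at hj
    refine mul_mem_lowDeg (a := b + d * (a₀ + 1)) (b := (J - 1) * L + 1)
      (add_mem_lowDeg (mem_lowDeg_mono ?_ (hA j)) ?_) (X_pow_mem_lowDeg ?_) (by omega)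
    · have := Nat.le_mul_of_pos_left (a₀ + 1) hd0
      omega
    · refine mul_mem_lowDeg (hB j) (mem_lowDeg_of_natDegree_lt (Nat.lt_succ_self _)) ?_
      rw [hfm.natDegree_pow, ← hdd, mul_comm d]
      omega
    · have : j * L ≤ (J - 1) * L := Nat.mul_le_mul_right L (by omega)
      omega
  have hfin := (card_mul_le_natDegree (Finset.filter_subset _ _) hH0 hdvd).trans hdeg
  rw [hQ, ← hL, ← hdd]
  have hJ1 : J - 1 = e₀ + d + 1 := by omega
  rw [hJ1] at hfin
  have h8 : b + d * (a₀ + 1) + (e₀ + d + 1) * L - 1 ≤ b + d * (a₀ + 1) + (e₀ + d + 1) * L :=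
    Nat.sub_le _ _
  have h9 : 2 * (b + d * (a₀ + 1) + (e₀ + d + 1) * L) ≤ M * L + (3 * d + 2) * L := by
    have : 2 * (e₀ + d + 1) = M + 2 * d + 1 := by omega
    have h10 : 2 * (d * (a₀ + 1)) = d * L + d := by
      rw [ha₀]; ring
    have h11 : 2 * b + 2 * d = L + 1 := by omega
    calc 2 * (b + d * (a₀ + 1) + (e₀ + d + 1) * L)
        = 2 * b + 2 * (d * (a₀ + 1)) + 2 * (e₀ + d + 1) * L := by ring
      _ = 2 * b + (d * L + d) + (M + 2 * d + 1) * L := by rw [h10, this]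
      _ = (2 * b + d) + (M * L + (3 * d + 1) * L) := by ring
      _ ≤ L + (M * L + (3 * d + 1) * L) := by gcongr; omega
      _ = M * L + (3 * d + 2) * L := by ring
  omega

/-- Square-root cancellation for a quadratic character over the primes of degree `n`. -/
lemma abs_sum_quadCharP_le (h2 : ringChar Fq ≠ 2) {n : ℕ} (hn : 2 ≤ n)
    (hq : 2 * n ≤ Fintype.card Fq ^ (n - n / 2)) (d : ℕ) :
    ∀ f : Fq[X], f.Monic → ¬ IsSquare f → f.natDegree = d → d < n →
    |∑ P ∈ irrDeg Fq n, quadCharP f P| * n ≤ (3 * n + 4 : ℤ) * (Fintype.card Fq : ℤ) ^ (n - n / 2) := by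
  induction d using Nat.strong_induction_on with
  | _ d ih =>
  intro f hfm hf hfd hdn
  by_cases hX : X ^ 2 ∣ f
  · obtain ⟨g, hg⟩ := hX
    have hgm : g.Monic := by
      rw [hg] at hfm
      exact (monic_X_pow 2).of_mul_monic_left hfm
    have hdeg : g.natDegree + 2 = d := by
      rw [← hfd, hg, (monic_X_pow 2).natDegree_mul hgm, natDegree_X_pow, add_comm]
    have hgs : ¬ IsSquare g := by
      rintro ⟨r, hr⟩
      exact hf ⟨X * r, by rw [hg, hr]; ring⟩
    have h := ih g.natDegree (by omega) g hgm hgs rfl (by omega)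
    rw [Finset.sum_congr rfl fun P hP => ?_]
    · exact h
    have hPi := mem_irrDeg.mp hP
    have hPX : ¬ P ∣ X := fun hd => by
      have := natDegree_le_of_dvd hd X_ne_zero
      rw [natDegree_X] at this
      omega
    rw [hg, quadCharP_mul hPi.2.1, quadCharP_pow hPi.2.1, quadCharP_sq_eq_one hPi.2.1 hPX, one_mul]
  · have hnn : n / 2 + (n - n / 2) = n := by omega
    have hb : ∀ ε : ℤ, 2 * (((irrDeg Fq n).filter (fun P => quadCharP f P = ε)).card * (n : ℤ)) ≤
        (Fintype.card Fq : ℤ) ^ n + (3 * d + 2) * (Fintype.card Fq : ℤ) ^ (n - n / 2) := by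
      intro ε
      have := card_quadCharP_eq_le h2 hfm hf hX ε (N₁ := n / 2) (N₂ := n - n / 2) (by omega)
        (by omega)
      rw [hnn, hfd] at this
      exact_mod_cast this
    have hnd : ∀ P ∈ irrDeg Fq n, ¬ P ∣ f := fun P hP hd => by
      have := natDegree_le_of_dvd hd hfm.ne_zero
      have := (mem_irrDeg.mp hP).2.2
      omega
    have hval : ∀ P ∈ irrDeg Fq n, quadCharP f P =
        (if quadCharP f P = 1 then (1 : ℤ) else 0) - if quadCharP f P = -1 then 1 else 0 := by
      intro P hP
      rcases quadCharP_eq_one_or (mem_irrDeg.mp hP).2.1 (hnd P hP) with h | h <;> simp [h]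
    have hval1 : ∀ P ∈ irrDeg Fq n, (1 : ℤ) =
        (if quadCharP f P = 1 then (1 : ℤ) else 0) + if quadCharP f P = -1 then 1 else 0 := by
      intro P hP
      rcases quadCharP_eq_one_or (mem_irrDeg.mp hP).2.1 (hnd P hP) with h | h <;> simp [h]
    have hs : ∑ P ∈ irrDeg Fq n, quadCharP f P =
        ((irrDeg Fq n).filter (fun P => quadCharP f P = 1)).card -
        ((irrDeg Fq n).filter (fun P => quadCharP f P = -1)).card := by
      rw [Finset.sum_congr rfl hval, Finset.sum_sub_distrib, Finset.sum_boole, Finset.sum_boole]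
    have hc : ((irrDeg Fq n).card : ℤ) =
        ((irrDeg Fq n).filter (fun P => quadCharP f P = 1)).card +
        ((irrDeg Fq n).filter (fun P => quadCharP f P = -1)).card := by
      rw [Finset.card_eq_sum_ones, Nat.cast_sum, Nat.cast_one, Finset.sum_congr rfl hval1,
        Finset.sum_add_distrib, Finset.sum_boole, Finset.sum_boole]
    have hp : (Fintype.card Fq : ℤ) ^ n ≤
        n * (irrDeg Fq n).card + 2 * (Fintype.card Fq : ℤ) ^ (n / 2) := by
      exact_mod_cast card_pow_le_irrDeg' (Fq := Fq) (n := n) (by omega)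
    have hle : (Fintype.card Fq : ℤ) ^ (n / 2) ≤ (Fintype.card Fq : ℤ) ^ (n - n / 2) := by
      exact_mod_cast Nat.pow_le_pow_right (Fintype.card_pos (α := Fq)) (by omega)
    have h1 := hb 1
    have h3 := hb (-1)
    have hLpos : (0 : ℤ) ≤ (Fintype.card Fq : ℤ) ^ (n - n / 2) := by positivity
    have hdn' : (3 * d + 2 : ℤ) * (Fintype.card Fq : ℤ) ^ (n - n / 2) ≤
        (3 * n + 2) * (Fintype.card Fq : ℤ) ^ (n - n / 2) := by
      gcongr
    rw [hc] at hp
    have hnpos : (n : ℤ) = |(n : ℤ)| := (abs_of_nonneg (by positivity)).symm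
    rw [hs]
    conv_lhs => rw [hnpos]
    rw [← abs_mul, abs_le]
    constructor <;> nlinarith

/-- The monic polynomials of degree at most `x`. -/
noncomputable def monLE (Fq : Type) [Field Fq] [Fintype Fq] (x : ℕ) : Finset Fq[X] :=
  (lowDeg Fq (x + 1)).filter Monic

lemma mem_monLE {x : ℕ} {f : Fq[X]} : f ∈ monLE Fq x ↔ f.Monic ∧ f.natDegree ≤ x := by
  rw [monLE, Finset.mem_filter, and_comm]
  refine and_congr_right fun _ => ⟨fun h => ?_, fun h => ?_⟩
  · exact Nat.lt_succ_iff.mp (natDegree_lt_of_mem_lowDeg (Nat.succ_pos x) h)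
  · exact mem_lowDeg_of_natDegree_lt (Nat.lt_succ_of_le h)

lemma sum_monLE_eq (x : ℕ) (G : Fq[X] → ℝ) :
    ∑ f ∈ monLE Fq x, G f = ∑ j ∈ Finset.range (x + 1), ∑ f ∈ monDeg Fq j, G f := by
  rw [← Finset.sum_fiberwise_of_maps_to (t := Finset.range (x + 1)) (g := natDegree)]
  · refine Finset.sum_congr rfl fun j hj => Finset.sum_congr ?_ fun _ _ => rfl
    ext f
    rw [Finset.mem_range] at hj
    rw [Finset.mem_filter, mem_monLE, mem_monDeg]
    exact ⟨fun h => ⟨h.1.1, h.2⟩, fun h => ⟨⟨h.1, by omega⟩, h.2⟩⟩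
  · intro f hf
    rw [Finset.mem_range, Nat.lt_succ_iff]
    exact (mem_monLE.mp hf).2

lemma sum_monLE_natDegree (x : ℕ) (G : ℕ → ℝ) :
    ∑ f ∈ monLE Fq x, G f.natDegree =
      ∑ j ∈ Finset.range (x + 1), (Fintype.card Fq : ℝ) ^ j * G j := by
  rw [sum_monLE_eq x fun f => G f.natDegree]
  refine Finset.sum_congr rfl fun j _ => ?_
  rw [Finset.sum_congr rfl fun f hf => by rw [(mem_monDeg.mp hf).2], Finset.sum_const,
    card_monDeg, nsmul_eq_mul, Nat.cast_pow]

lemma sum_monLE_tq_sq (x : ℕ) : ∑ f ∈ monLE Fq x, tq Fq ^ (2 * f.natDegree) = x + 1 := by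
  rw [sum_monLE_natDegree x fun j => tq Fq ^ (2 * j)]
  rw [Finset.sum_congr rfl fun j _ => by
    rw [pow_mul, ← mul_pow, mul_comm, tq_sq, one_pow]]
  simp

lemma sum_monLE_tq_four (x : ℕ) : ∑ f ∈ monLE Fq x, (tq Fq ^ (2 * f.natDegree)) ^ 2 ≤ 2 := by
  have hq : (2 : ℝ) ≤ Fintype.card Fq := by exact_mod_cast Fintype.one_lt_card (α := Fq)
  have ht : tq Fq ^ 2 ≤ 1 / 2 := by
    have h := tq_sq (Fq := Fq)
    have := sq_nonneg (tq Fq)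
    nlinarith
  rw [sum_monLE_natDegree x fun j => (tq Fq ^ (2 * j)) ^ 2]
  calc ∑ j ∈ Finset.range (x + 1), (Fintype.card Fq : ℝ) ^ j * (tq Fq ^ (2 * j)) ^ 2
      = ∑ j ∈ Finset.range (x + 1), (tq Fq ^ 2) ^ j := by
        refine Finset.sum_congr rfl fun j _ => ?_
        rw [pow_mul, pow_two ((tq Fq ^ 2) ^ j), ← mul_assoc, ← mul_pow, mul_comm _ (tq Fq ^ 2),
          tq_sq, one_pow, one_mul]
    _ ≤ ∑ j ∈ Finset.range (x + 1), (1 / 2 : ℝ) ^ j := by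
        gcongr
    _ ≤ 2 := sum_geometric_two_le _

lemma exists_gcd_factorization {u v : Fq[X]} (hu : u.Monic) (hv : v.Monic) :
    ∃ g a b : Fq[X], g.Monic ∧ a.Monic ∧ b.Monic ∧ u = a * g ∧ v = b * g ∧ IsCoprime a b := by
  set d := EuclideanDomain.gcd u v with hd
  have hd0 : d ≠ 0 := fun h => hu.ne_zero (EuclideanDomain.gcd_eq_zero_iff.mp h).1
  have hc : d.leadingCoeff ≠ 0 := leadingCoeff_ne_zero.mpr hd0
  obtain ⟨a, ha⟩ := EuclideanDomain.gcd_dvd_left u v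
  obtain ⟨b, hb⟩ := EuclideanDomain.gcd_dvd_right u v
  rw [← hd] at ha hb
  have hgm : (C d.leadingCoeff⁻¹ * d).Monic := by
    rw [mul_comm]
    exact monic_mul_leadingCoeff_inv hd0
  have hcc : C d.leadingCoeff * C d.leadingCoeff⁻¹ = 1 := by
    rw [← C_mul, mul_inv_cancel₀ hc, C_1]
  have e1 : u = C d.leadingCoeff * a * (C d.leadingCoeff⁻¹ * d) := by
    linear_combination ha - d * a * hcc
  have e2 : v = C d.leadingCoeff * b * (C d.leadingCoeff⁻¹ * d) := by
    linear_combination hb - d * b * hcc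
  refine ⟨C d.leadingCoeff⁻¹ * d, C d.leadingCoeff * a, C d.leadingCoeff * b, hgm,
    hgm.of_mul_monic_right (e1 ▸ hu), hgm.of_mul_monic_right (e2 ▸ hv), e1, e2, ?_⟩
  have hbez := EuclideanDomain.gcd_eq_gcd_ab u v
  rw [← hd] at hbez
  have h1 : a * EuclideanDomain.gcdA u v + b * EuclideanDomain.gcdB u v = 1 := by
    apply mul_left_cancel₀ hd0
    linear_combination -hbez - EuclideanDomain.gcdA u v * ha - EuclideanDomain.gcdB u v * hb
  exact ⟨C d.leadingCoeff⁻¹ * EuclideanDomain.gcdA u v, C d.leadingCoeff⁻¹ *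
    EuclideanDomain.gcdB u v, by linear_combination h1 + hcc * (a * EuclideanDomain.gcdA u v +
      b * EuclideanDomain.gcdB u v)⟩

/-- Tuples of monic polynomials of degree at most `y`, coprime at the pairs in `Λ`. -/
noncomputable def coprimeTuples (Fq : Type) [Field Fq] [Fintype Fq] {S : Type} [Fintype S] (y : ℕ)
    (Λ : Finset (S × S)) : Finset (S → Fq[X]) :=
  (Fintype.piFinset fun _ : S => monLE Fq y).filter fun u => ∀ p ∈ Λ, IsCoprime (u p.1) (u p.2)

lemma mem_coprimeTuples {S : Type} [Fintype S] {y : ℕ} {Λ : Finset (S × S)} {u : S → Fq[X]} :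
    u ∈ coprimeTuples Fq y Λ ↔
      (∀ s, u s ∈ monLE Fq y) ∧ ∀ p ∈ Λ, IsCoprime (u p.1) (u p.2) := by
  rw [coprimeTuples, Finset.mem_filter, Fintype.mem_piFinset]

lemma sum_coprimeTuples_le {S : Type} [Fintype S] (y : ℕ) (Λ : Finset (S × S)) {s s' : S}
    (hs : s ≠ s') :
    ∑ u ∈ coprimeTuples Fq y Λ, ∏ r, tq Fq ^ (2 * (u r).natDegree) ≤
      2 * ∑ u ∈ coprimeTuples Fq y (insert (s, s') Λ), ∏ r, tq Fq ^ (2 * (u r).natDegree) := by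
  have hex : ∀ u ∈ coprimeTuples Fq y Λ, ∃ p : Fq[X] × (S → Fq[X]),
      p ∈ monLE Fq y ×ˢ coprimeTuples Fq y (insert (s, s') Λ) ∧
      ∀ r, u r = p.2 r * (if r = s ∨ r = s' then p.1 else 1) := by
    intro u hu
    rw [mem_coprimeTuples] at hu
    have hm : ∀ r, (u r).Monic := fun r => (mem_monLE.mp (hu.1 r)).1
    obtain ⟨g, a, b, hg, ha, hb, h1, h2, hab⟩ := exists_gcd_factorization (hm s) (hm s')
    have hmul : ∀ r, u r = Function.update (Function.update u s a) s' b r *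
        (if r = s ∨ r = s' then g else 1) := by
      intro r
      by_cases h : r = s'
      · subst h
        simp [h2]
      · by_cases h' : r = s
        · subst h'
          simp [h, h1]
        · simp [h, h']
    have hU : ∀ r, (Function.update (Function.update u s a) s' b r).Monic := by
      intro r
      by_cases h : r = s'
      · subst h
        simpa using hb
      · by_cases h' : r = s
        · subst h'
          simpa [h] using ha
        · simpa [h, h'] using hm r
    refine ⟨(g, Function.update (Function.update u s a) s' b), ?_, hmul⟩
    rw [Finset.mem_product, mem_monLE, mem_coprimeTuples]
    have hdvd : ∀ r, Function.update (Function.update u s a) s' b r ∣ u r :=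
      fun r => ⟨_, hmul r⟩
    refine ⟨⟨hg, ?_⟩, fun r => ?_, fun p hp => ?_⟩
    · exact (natDegree_le_of_dvd ⟨a, by rw [h1, mul_comm]⟩ (hm s).ne_zero).trans
        (mem_monLE.mp (hu.1 s)).2
    · rw [mem_monLE]
      exact ⟨hU r, (natDegree_le_of_dvd (hdvd r) (hm r).ne_zero).trans (mem_monLE.mp (hu.1 r)).2⟩
    · rw [Finset.mem_insert] at hp
      rcases hp with rfl | hp
      · simpa [hs] using hab
      · exact ((hu.2 p hp).of_isCoprime_of_dvd_left (hdvd _)).of_isCoprime_of_dvd_right (hdvd _)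
  choose! φ hφ hφ' using hex
  have hinj : Set.InjOn φ (coprimeTuples Fq y Λ) := by
    intro u hu v hv h
    ext1 r
    rw [hφ' u hu r, hφ' v hv r, h]
  have hcard : (Finset.univ.filter fun r : S => r = s ∨ r = s').card = 2 := by
    rw [← Finset.card_pair hs]
    congr 1
    ext r
    simp
  have hw : ∀ u ∈ coprimeTuples Fq y Λ, ∏ r, tq Fq ^ (2 * (u r).natDegree) =
      (tq Fq ^ (2 * (φ u).1.natDegree)) ^ 2 * ∏ r, tq Fq ^ (2 * ((φ u).2 r).natDegree) := by
    intro u hu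
    have h1 := hφ u hu
    rw [Finset.mem_product, mem_monLE, mem_coprimeTuples] at h1
    have h2 : ∀ r, tq Fq ^ (2 * (u r).natDegree) = (if r = s ∨ r = s' then
        tq Fq ^ (2 * (φ u).1.natDegree) else 1) * tq Fq ^ (2 * ((φ u).2 r).natDegree) := by
      intro r
      rw [hφ' u hu r]
      split_ifs with h
      · rw [(mem_monLE.mp (h1.2.1 r)).1.natDegree_mul h1.1.1, ← pow_add]
        congr 1
        ring
      · simp
    simp only [h2]
    rw [Finset.prod_mul_distrib, Finset.prod_ite, Finset.prod_const, hcard, Finset.prod_const_one,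
      mul_one]
  have hnn : ∀ u : S → Fq[X], 0 ≤ ∏ r, tq Fq ^ (2 * (u r).natDegree) := fun u =>
    Finset.prod_nonneg fun r _ => pow_nonneg tq_pos.le _
  rw [Finset.sum_congr rfl hw]
  calc ∑ u ∈ coprimeTuples Fq y Λ,
        (tq Fq ^ (2 * (φ u).1.natDegree)) ^ 2 * ∏ r, tq Fq ^ (2 * ((φ u).2 r).natDegree)
      = ∑ p ∈ (coprimeTuples Fq y Λ).image φ,
        (tq Fq ^ (2 * p.1.natDegree)) ^ 2 * ∏ r, tq Fq ^ (2 * (p.2 r).natDegree) :=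
        (Finset.sum_image (f := fun p : Fq[X] × (S → Fq[X]) =>
          (tq Fq ^ (2 * p.1.natDegree)) ^ 2 * ∏ r, tq Fq ^ (2 * (p.2 r).natDegree)) hinj).symm
    _ ≤ ∑ p ∈ monLE Fq y ×ˢ coprimeTuples Fq y (insert (s, s') Λ),
        (tq Fq ^ (2 * p.1.natDegree)) ^ 2 * ∏ r, tq Fq ^ (2 * (p.2 r).natDegree) := by
        refine Finset.sum_le_sum_of_subset_of_nonneg ?_ fun p _ _ => mul_nonneg (sq_nonneg _) (hnn _)
        intro p hp
        obtain ⟨u, hu, rfl⟩ := Finset.mem_image.mp hp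
        exact hφ u hu
    _ = (∑ g ∈ monLE Fq y, (tq Fq ^ (2 * g.natDegree)) ^ 2) *
        ∑ u ∈ coprimeTuples Fq y (insert (s, s') Λ), ∏ r, tq Fq ^ (2 * (u r).natDegree) := by
        rw [Finset.sum_product, Finset.sum_mul_sum]
    _ ≤ _ := mul_le_mul_of_nonneg_right (sum_monLE_tq_four y) (Finset.sum_nonneg fun u _ => hnn u)

lemma le_sum_coprimeTuples {S : Type} [Fintype S] (y : ℕ) (Λ : Finset (S × S))
    (hΛ : ∀ p ∈ Λ, p.1 ≠ p.2) : (y + 1 : ℝ) ^ Fintype.card S ≤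
      2 ^ Λ.card * ∑ u ∈ coprimeTuples Fq y Λ, ∏ r, tq Fq ^ (2 * (u r).natDegree) := by
  induction Λ using Finset.induction_on with
  | empty =>
    rw [Finset.card_empty, pow_zero, one_mul]
    have : coprimeTuples Fq y (∅ : Finset (S × S)) = Fintype.piFinset fun _ : S => monLE Fq y := by
      simp [coprimeTuples]
    have h1 := Finset.prod_univ_sum (fun _ : S => monLE Fq y)
      (fun _ (f : Fq[X]) => tq Fq ^ (2 * f.natDegree))
    rw [this, ← h1, Finset.prod_congr rfl fun _ _ => sum_monLE_tq_sq y]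
    simp
  | insert p Λ hp ih =>
    have h1 := ih fun p hp => hΛ p (Finset.mem_insert_of_mem hp)
    have h2 := sum_coprimeTuples_le (Fq := Fq) y Λ (hΛ p (Finset.mem_insert_self p Λ))
    rw [Finset.card_insert_of_notMem hp, pow_succ, mul_assoc]
    exact h1.trans (mul_le_mul_of_nonneg_left h2 (by positivity))

/-- The unordered pairs from `Fin k`, represented as ordered pairs. -/
abbrev OrdPair (k : ℕ) : Type := {p : Fin k × Fin k // p.1 ≤ p.2}

lemma card_ordPair (k : ℕ) : Fintype.card (OrdPair k) = k * (k + 1) / 2 := by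
  rw [← Fintype.card_congr (Sym2.sortEquiv (α := Fin k)), Sym2.card, Fintype.card_fin,
    Nat.choose_two_right, Nat.add_sub_cancel, mul_comm]

/-- The `k` polynomials built from a family indexed by unordered pairs. -/
noncomputable def pairProd {k : ℕ} (u : OrdPair k → Fq[X]) (i : Fin k) : Fq[X] :=
  (∏ s with s.1.1 = i, u s) * ∏ s with s.1.2 = i, u s

lemma prod_pairProd {k : ℕ} (u : OrdPair k → Fq[X]) : ∏ i, pairProd u i = (∏ s, u s) ^ 2 := by
  simp only [pairProd]
  rw [Finset.prod_mul_distrib, Finset.prod_fiberwise, Finset.prod_fiberwise, pow_two]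

lemma monic_pairProd {k : ℕ} {u : OrdPair k → Fq[X]} (hu : ∀ s, (u s).Monic) (i : Fin k) :
    (pairProd u i).Monic :=
  (monic_prod_of_monic _ _ fun s _ => hu s).mul (monic_prod_of_monic _ _ fun s _ => hu s)

lemma natDegree_pairProd_le {k y : ℕ} {u : OrdPair k → Fq[X]} (hu : ∀ s, u s ∈ monLE Fq y)
    (i : Fin k) : (pairProd u i).natDegree ≤ 2 * (k * (k + 1) / 2) * y := by
  have h : ∀ A : Finset (OrdPair k), (∏ s ∈ A, u s).natDegree ≤ (k * (k + 1) / 2) * y := by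
    intro A
    rw [natDegree_prod_of_monic _ _ fun s _ => (mem_monLE.mp (hu s)).1, ← card_ordPair]
    refine (Finset.sum_le_card_nsmul _ _ y fun s _ => (mem_monLE.mp (hu s)).2).trans ?_
    rw [smul_eq_mul]
    exact Nat.mul_le_mul_right y (Finset.card_le_univ A)
  rw [mul_assoc, two_mul]
  exact natDegree_mul_le.trans (add_le_add (h _) (h _))

lemma prod_tq_pairProd {k : ℕ} {u : OrdPair k → Fq[X]} (hu : ∀ s, (u s).Monic) :
    ∏ i, tq Fq ^ (pairProd u i).natDegree = ∏ s, tq Fq ^ (2 * (u s).natDegree) := by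
  rw [Finset.prod_pow_eq_pow_sum, Finset.prod_pow_eq_pow_sum,
    ← natDegree_prod_of_monic _ _ fun i _ => monic_pairProd hu i, prod_pairProd, natDegree_pow,
    natDegree_prod_of_monic _ _ fun s _ => hu s, Finset.mul_sum]

lemma pairProd_injOn {k : ℕ} {u v : OrdPair k → Fq[X]} (hu : ∀ s, (u s).Monic)
    (hv : ∀ s, (v s).Monic) (huc : ∀ s t, s ≠ t → IsCoprime (u s) (u t))
    (hvc : ∀ s t, s ≠ t → IsCoprime (v s) (v t)) (h : pairProd u = pairProd v) : u = v := by
  have hfac : ∀ (w : OrdPair k → Fq[X]), (∀ s t, s ≠ t → IsCoprime (w s) (w t)) →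
      ∀ s : OrdPair k, s.1.1 ≠ s.1.2 → ∃ a b, pairProd w s.1.1 = w s * a ∧
        pairProd w s.1.2 = w s * b ∧ IsCoprime a b := by
    intro w hw s hs
    have hs' : s.1.1 < s.1.2 := lt_of_le_of_ne s.2 hs
    refine ⟨(∏ t ∈ (Finset.univ.filter fun t : OrdPair k => t.1.1 = s.1.1).erase s, w t) *
      ∏ t with t.1.2 = s.1.1, w t,
      (∏ t with t.1.1 = s.1.2, w t) *
        ∏ t ∈ (Finset.univ.filter fun t : OrdPair k => t.1.2 = s.1.2).erase s, w t, ?_, ?_, ?_⟩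
    · rw [← mul_assoc, Finset.mul_prod_erase _ _ (by simp)]
      rfl
    · rw [mul_left_comm, Finset.mul_prod_erase _ _ (by simp)]
      rfl
    · have hne : ∀ {t t' : OrdPair k}, t ≠ t' → IsCoprime (w t) (w t') := fun h => hw _ _ h
      rw [IsCoprime.mul_left_iff, IsCoprime.mul_right_iff, IsCoprime.mul_right_iff]
      refine ⟨⟨?_, ?_⟩, ?_, ?_⟩ <;>
        refine IsCoprime.prod_left fun t ht => IsCoprime.prod_right fun t' ht' => hne ?_ <;>
        simp only [Finset.mem_erase, Finset.mem_filter, Finset.mem_univ, true_and] at ht ht' <;>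
        rintro rfl
      · exact hs (ht.2.symm.trans ht')
      · exact ht.1 (Subtype.ext (Prod.ext ht.2 ht'.2))
      · have := t.2
        rw [ht, ht'] at this
        exact absurd this (not_le.mpr hs')
      · exact hs (ht.symm.trans ht'.2)
  have hdvd : ∀ (w w' : OrdPair k → Fq[X]), (∀ s t, s ≠ t → IsCoprime (w s) (w t)) →
      (∀ s t, s ≠ t → IsCoprime (w' s) (w' t)) → pairProd w = pairProd w' →
      ∀ s : OrdPair k, s.1.1 ≠ s.1.2 → w s ∣ w' s := by
    intro w w' hw hw' he s hs
    obtain ⟨a, b, h1, h2, -⟩ := hfac w hw s hs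
    obtain ⟨a', b', h1', h2', r, t, hrt⟩ := hfac w' hw' s hs
    have e1 : w s * a = w' s * a' := by rw [← h1, ← h1', he]
    have e2 : w s * b = w' s * b' := by rw [← h2, ← h2', he]
    exact ⟨r * a + t * b, by linear_combination (-w' s) * hrt - r * e1 - t * e2⟩
  have hoff : ∀ s : OrdPair k, s.1.1 ≠ s.1.2 → u s = v s := fun s hs =>
    eq_of_monic_of_associated (hu s) (hv s) (associated_of_dvd_dvd (hdvd u v huc hvc h s hs)
      (hdvd v u hvc huc h.symm s hs))
  ext1 s
  by_cases hs : s.1.1 = s.1.2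
  · have hdec : ∀ w : OrdPair k → Fq[X], pairProd w s.1.1 = w s ^ 2 *
        ((∏ t ∈ (Finset.univ.filter fun t : OrdPair k => t.1.1 = s.1.1).erase s, w t) *
        ∏ t ∈ (Finset.univ.filter fun t : OrdPair k => t.1.2 = s.1.1).erase s, w t) := by
      intro w
      rw [pow_two, mul_mul_mul_comm, Finset.mul_prod_erase _ _ (by simp),
        Finset.mul_prod_erase _ _ (by simp [hs])]
      rfl
    have hrest : ∀ t : OrdPair k, t ≠ s → (t.1.1 = s.1.1 ∨ t.1.2 = s.1.1) → u t = v t := by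
      intro t ht hor
      apply hoff
      intro he
      apply ht
      apply Subtype.ext
      rcases hor with hor | hor
      · exact Prod.ext hor (by rw [← he, hor, hs])
      · exact Prod.ext (by rw [he, hor]) (by rw [hor, hs])
    have e := congrFun h s.1.1
    rw [hdec u, hdec v] at e
    rw [Finset.prod_congr rfl fun t ht => hrest t (Finset.ne_of_mem_erase ht)
      (Or.inl (Finset.mem_filter.mp (Finset.mem_of_mem_erase ht)).2)] at e
    rw [Finset.prod_congr rfl fun t ht => hrest t (Finset.ne_of_mem_erase ht)
      (Or.inr (Finset.mem_filter.mp (Finset.mem_of_mem_erase ht)).2)] at e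
    have e' := mul_right_cancel₀ (((monic_prod_of_monic _ _ fun t _ => hv t).mul
      (monic_prod_of_monic _ _ fun t _ => hv t)).ne_zero) e
    have d1 : u s ∣ v s := (IsIntegrallyClosed.pow_dvd_pow_iff two_ne_zero).mp e'.dvd
    have d2 : v s ∣ u s := (IsIntegrallyClosed.pow_dvd_pow_iff two_ne_zero).mp e'.symm.dvd
    exact eq_of_monic_of_associated (hu s) (hv s) (associated_of_dvd_dvd d1 d2)
  · exact hoff s hs

/-- The tuples of monic polynomials of degree at most `x` whose product is a square. -/
noncomputable def squareTuples (Fq : Type) [Field Fq] [Fintype Fq] (k x : ℕ) :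
    Finset (Fin k → Fq[X]) :=
  (Fintype.piFinset fun _ => monLE Fq x).filter fun f => IsSquare (∏ i, f i)

lemma le_sum_squareTuples {k : ℕ} {x y : ℕ} (hxy : 2 * (k * (k + 1) / 2) * y ≤ x) :
    (y + 1 : ℝ) ^ (k * (k + 1) / 2) ≤
      2 ^ (Finset.univ.filter fun p : OrdPair k × OrdPair k => p.1 ≠ p.2).card *
        ∑ f ∈ squareTuples Fq k x, ∏ i, tq Fq ^ (f i).natDegree := by
  rw [← card_ordPair]
  refine (le_sum_coprimeTuples (Fq := Fq) y (Finset.univ.filter fun p : OrdPair k × OrdPair k =>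
    p.1 ≠ p.2) fun p hp => (Finset.mem_filter.mp hp).2).trans ?_
  refine mul_le_mul_of_nonneg_left ?_ (by positivity)
  set T := coprimeTuples Fq y (Finset.univ.filter fun p : OrdPair k × OrdPair k => p.1 ≠ p.2)
    with hT
  have hT1 : ∀ u ∈ T, ∀ s, u s ∈ monLE Fq y := fun u hu => (mem_coprimeTuples.mp hu).1
  have hT2 : ∀ u ∈ T, ∀ s, (u s).Monic := fun u hu s => (mem_monLE.mp (hT1 u hu s)).1
  have hT3 : ∀ u ∈ T, ∀ s t, s ≠ t → IsCoprime (u s) (u t) := fun u hu s t hst =>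
    (mem_coprimeTuples.mp hu).2 (s, t) (by simpa using hst)
  have hinj : Set.InjOn (pairProd (Fq := Fq) (k := k)) T := fun u hu v hv h =>
    pairProd_injOn (hT2 u hu) (hT2 v hv) (hT3 u hu) (hT3 v hv) h
  rw [← Finset.sum_congr rfl fun u hu => prod_tq_pairProd (hT2 u hu),
    ← Finset.sum_image (f := fun f : Fin k → Fq[X] => ∏ i, tq Fq ^ (f i).natDegree) hinj]
  refine Finset.sum_le_sum_of_subset_of_nonneg ?_ fun f _ _ =>
    Finset.prod_nonneg fun i _ => pow_nonneg tq_pos.le _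
  intro f hf
  obtain ⟨u, hu, rfl⟩ := Finset.mem_image.mp hf
  rw [squareTuples, Finset.mem_filter, Fintype.mem_piFinset, prod_pairProd]
  refine ⟨fun i => mem_monLE.mpr ⟨monic_pairProd (hT2 u hu) i, ?_⟩, IsSquare.sq _⟩
  exact (natDegree_pairProd_le (hT1 u hu) i).trans hxy

lemma abs_sum_prod_quadCharP_sub_le (h2 : ringChar Fq ≠ 2) {n k : ℕ} (hn : 2 ≤ n)
    (hq : 2 * n ≤ Fintype.card Fq ^ (n - n / 2)) {F : Fin k → Fq[X]} (hF : ∀ i, (F i).Monic)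
    (hd : ∑ i, (F i).natDegree < n) :
    |∑ P ∈ irrDeg Fq n, ∏ i, (quadCharP (F i) P : ℝ) -
        (if IsSquare (∏ i, F i) then ((irrDeg Fq n).card : ℝ) else 0)| ≤
      (3 * n + 4) * (Fintype.card Fq : ℝ) ^ (n - n / 2) := by
  have hm : (∏ i, F i).Monic := monic_prod_of_monic _ _ fun i _ => hF i
  have hdeg : (∏ i, F i).natDegree < n := by
    rwa [natDegree_prod_of_monic _ _ fun i _ => hF i]
  have hnd : ∀ P ∈ irrDeg Fq n, ¬ P ∣ ∏ i, F i := fun P hP hdvd => by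
    have := natDegree_le_of_dvd hdvd hm.ne_zero
    have := (mem_irrDeg.mp hP).2.2
    omega
  have e : ∑ P ∈ irrDeg Fq n, ∏ i, (quadCharP (F i) P : ℝ) =
      ∑ P ∈ irrDeg Fq n, (quadCharP (∏ i, F i) P : ℝ) := by
    refine Finset.sum_congr rfl fun P hP => ?_
    rw [quadCharP_prod (mem_irrDeg.mp hP).2.1, Int.cast_prod]
  rw [e]
  split_ifs with hs
  · obtain ⟨r, hr⟩ := hs
    rw [Finset.sum_congr rfl fun P hP => ?_, Finset.sum_const, nsmul_eq_mul, mul_one, sub_self,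
      abs_zero]
    · positivity
    have h3 : ¬ P ∣ r := fun h => hnd P hP (hr ▸ h.mul_right r)
    rw [hr, ← pow_two, quadCharP_pow (mem_irrDeg.mp hP).2.1,
      quadCharP_sq_eq_one (mem_irrDeg.mp hP).2.1 h3, Int.cast_one]
  · rw [sub_zero, ← Int.cast_sum, ← Int.cast_abs]
    have h4 := abs_sum_quadCharP_le h2 hn hq _ _ hm hs rfl hdeg
    have h5 : |∑ P ∈ irrDeg Fq n, quadCharP (∏ i, F i) P| ≤
        (3 * n + 4 : ℤ) * (Fintype.card Fq : ℤ) ^ (n - n / 2) :=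
      (le_mul_of_one_le_right (abs_nonneg _) (by omega)).trans h4
    exact_mod_cast h5

/-- The mean value over primes of a product of character sums. -/
lemma abs_sum_prod_sum_sub_le (h2 : ringChar Fq ≠ 2) {n k : ℕ} (hn : 2 ≤ n)
    (hq : 2 * n ≤ Fintype.card Fq ^ (n - n / 2)) {D : Fin k → ℕ} (hD : ∑ i, D i < n)
    {T : Fin k → Finset Fq[X]} (hT : ∀ i, ∀ f ∈ T i, f.Monic ∧ f.natDegree ≤ D i)
    (c : Fin k → Fq[X] → ℝ) :
    |∑ P ∈ irrDeg Fq n, ∏ i, ∑ f ∈ T i, c i f * (quadCharP f P : ℝ) -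
        (irrDeg Fq n).card * ∑ F ∈ (Fintype.piFinset T).filter fun F => IsSquare (∏ i, F i),
          ∏ i, c i (F i)| ≤
      (3 * n + 4) * (Fintype.card Fq : ℝ) ^ (n - n / 2) * ∏ i, ∑ f ∈ T i, |c i f| := by
  have e1 : ∑ P ∈ irrDeg Fq n, ∏ i, ∑ f ∈ T i, c i f * (quadCharP f P : ℝ) =
      ∑ F ∈ Fintype.piFinset T, (∏ i, c i (F i)) *
        ∑ P ∈ irrDeg Fq n, ∏ i, (quadCharP (F i) P : ℝ) := by
    simp only [Finset.prod_univ_sum, Finset.prod_mul_distrib, Finset.mul_sum]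
    exact Finset.sum_comm
  have e2 : (irrDeg Fq n).card * ∑ F ∈ (Fintype.piFinset T).filter fun F => IsSquare (∏ i, F i),
      ∏ i, c i (F i) = ∑ F ∈ Fintype.piFinset T, (∏ i, c i (F i)) *
        (if IsSquare (∏ i, F i) then ((irrDeg Fq n).card : ℝ) else 0) := by
    rw [Finset.sum_filter, Finset.mul_sum]
    refine Finset.sum_congr rfl fun F _ => ?_
    split_ifs
    · rw [mul_comm]
    · simp
  rw [e1, e2, ← Finset.sum_sub_distrib, Finset.prod_univ_sum, Finset.mul_sum]
  refine (Finset.abs_sum_le_sum_abs _ _).trans (Finset.sum_le_sum fun F hF => ?_)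
  rw [Fintype.mem_piFinset] at hF
  rw [← mul_sub, abs_mul, Finset.abs_prod, mul_comm]
  refine mul_le_mul_of_nonneg_right ?_ (Finset.prod_nonneg fun i _ => abs_nonneg _)
  exact abs_sum_prod_quadCharP_sub_le h2 hn hq (fun i => (hT i _ (hF i)).1)
    ((Finset.sum_le_sum fun i _ => (hT i _ (hF i)).2).trans_lt hD)

lemma even_pow_tangent {k : ℕ} (hk : Even k) (a b : ℝ) :
    k * (b * a ^ (k - 1)) - (k - 1) * a ^ k ≤ b ^ k := by
  rcases Nat.eq_zero_or_pos k with rfl | hpos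
  · simp
  by_cases ha : a = 0
  · subst ha
    obtain ⟨m, rfl⟩ : ∃ m, k = m + 1 := ⟨k - 1, by omega⟩
    have hm : m ≠ 0 := by
      rintro rfl
      exact absurd hk (by decide)
    simp only [Nat.add_sub_cancel, zero_pow hm, zero_pow (Nat.succ_ne_zero m)]
    simpa using hk.pow_nonneg b
  · have h1 : 1 + k * (b / a - 1) ≤ (b / a) ^ k := by
      by_cases h : -2 ≤ b / a - 1
      · have := one_add_mul_le_pow h k
        rwa [add_sub_cancel] at this
      · have h3 : (1 : ℝ) ≤ k := by exact_mod_cast hpos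
        exact le_trans (by nlinarith) (hk.pow_nonneg (b / a))
    have h2 := mul_le_mul_of_nonneg_right h1 (hk.pow_nonneg a)
    rw [div_pow, div_mul_cancel₀ _ (pow_ne_zero k ha)] at h2
    refine le_trans (le_of_eq ?_) h2
    obtain ⟨m, rfl⟩ : ∃ m, k = m + 1 := ⟨k - 1, by omega⟩
    rw [Nat.add_sub_cancel]
    field_simp
    ring

lemma sum_monLE_tq_le (x : ℕ) :
    ∑ f ∈ monLE Fq x, tq Fq ^ f.natDegree ≤ (x + 1) * √(Fintype.card Fq : ℝ) ^ x := by
  have hq : (1 : ℝ) ≤ Fintype.card Fq := by exact_mod_cast Fintype.card_pos (α := Fq)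
  have hs : (1 : ℝ) ≤ √(Fintype.card Fq : ℝ) := Real.one_le_sqrt.mpr hq
  have he : (Fintype.card Fq : ℝ) * tq Fq = √(Fintype.card Fq : ℝ) := by
    rw [tq, ← div_eq_mul_inv, Real.div_sqrt]
  rw [sum_monLE_natDegree x fun j => tq Fq ^ j]
  calc ∑ j ∈ Finset.range (x + 1), (Fintype.card Fq : ℝ) ^ j * tq Fq ^ j
      = ∑ j ∈ Finset.range (x + 1), √(Fintype.card Fq : ℝ) ^ j := by
        simp only [← mul_pow, he]
    _ ≤ ∑ j ∈ Finset.range (x + 1), √(Fintype.card Fq : ℝ) ^ x := by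
        refine Finset.sum_le_sum fun j hj => pow_le_pow_right₀ hs ?_
        rw [Finset.mem_range] at hj
        omega
    _ = _ := by simp

lemma prod_sign_mul_tq_pow {n k : ℕ} {F : Fin k → Fq[X]} (hF : ∀ i, (F i).Monic)
    (hs : IsSquare (∏ i, F i)) :
    ∏ i, ((recSign Fq n : ℝ) * tq Fq) ^ (F i).natDegree = ∏ i, tq Fq ^ (F i).natDegree := by
  obtain ⟨r, hr⟩ := hs
  have h1 : (recSign Fq n : ℝ) ^ 2 = 1 := by exact_mod_cast recSign_sq _
  simp only [mul_pow]
  rw [Finset.prod_mul_distrib, Finset.prod_pow_eq_pow_sum,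
    ← natDegree_prod_of_monic _ _ fun i _ => hF i, hr, ← pow_two, natDegree_pow, pow_mul, h1,
    one_pow, one_mul]

lemma abs_sign_mul_tq_pow (n j : ℕ) : |((recSign Fq n : ℝ) * tq Fq) ^ j| = tq Fq ^ j := by
  have h1 : (recSign Fq n : ℝ) ^ 2 = 1 := by exact_mod_cast recSign_sq _
  have h2 : |(recSign Fq n : ℝ)| = 1 := by
    rw [← abs_one, ← sq_eq_sq_iff_abs_eq_abs, h1, one_pow]
  rw [abs_pow, abs_mul, h2, one_mul, abs_of_pos tq_pos]

/-- Lower bound for the moment over primes by a diagonal sum, up to an explicit error. -/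
lemma le_sum_LhalfR_pow (h2 : ringChar Fq ≠ 2) {n m x : ℕ} (hn : 2 ≤ n)
    (hq : 2 * n ≤ Fintype.card Fq ^ (n - n / 2)) (hx : x + 2 ≤ (n - 1) / 2)
    (hD : (n - 1) / 2 + m * x < n) (hk : Even (m + 1)) :
    (irrDeg Fq n).card * ∑ f ∈ squareTuples Fq (m + 1) x, ∏ i, tq Fq ^ (f i).natDegree -
      (2 * m + 1) * ((3 * n + 4) * (Fintype.card Fq : ℝ) ^ (n - n / 2) *
        (2 * (((n - 1) / 2 : ℕ) + 1) * √(Fintype.card Fq : ℝ) ^ ((n - 1) / 2) *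
          ((x + 1) * √(Fintype.card Fq : ℝ) ^ x) ^ m)) ≤
      ∑ P ∈ irrDeg Fq n, LhalfR P ^ (m + 1) := by
  obtain ⟨w, hw, hw1, hL⟩ := exists_weights h2 (n := n) (by omega)
  obtain ⟨g, hg⟩ : ∃ g, g = (n - 1) / 2 := ⟨_, rfl⟩
  obtain ⟨s, hs⟩ : ∃ s, s = √(Fintype.card Fq : ℝ) := ⟨_, rfl⟩
  obtain ⟨Bd, hBd⟩ : ∃ Bd, Bd = (3 * n + 4) * (Fintype.card Fq : ℝ) ^ (n - n / 2) := ⟨_, rfl⟩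
  rw [← hg] at hw hw1 hL hx hD
  rw [← hg, ← hs, ← hBd]
  have hBd0 : 0 ≤ Bd := hBd ▸ by positivity
  have hs1 : 1 ≤ s := by
    rw [hs]
    exact Real.one_le_sqrt.mpr (by exact_mod_cast Fintype.card_pos (α := Fq))
  set z : ℝ := (recSign Fq n : ℝ) * tq Fq with hz
  set cL : Fq[X] → ℝ := fun f => w f.natDegree * z ^ f.natDegree with hcL
  set cA : Fq[X] → ℝ := fun f => z ^ f.natDegree with hcA
  set A : Fq[X] → ℝ := fun P => ∑ f ∈ monLE Fq x, cA f * (quadCharP f P : ℝ) with hA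
  have hLP : ∀ P ∈ irrDeg Fq n, LhalfR P = ∑ f ∈ monLE Fq g, cL f * (quadCharP f P : ℝ) := by
    intro P hP
    have hPi := mem_irrDeg.mp hP
    rw [hL P hPi.2.1 hPi.1 hPi.2.2, sum_monLE_eq]
    refine Finset.sum_congr rfl fun j _ => ?_
    rw [Finset.sum_mul, Finset.mul_sum]
    refine Finset.sum_congr rfl fun f hf => ?_
    rw [mem_monDeg] at hf
    rw [jacobi_reciprocity h2 hPi.2.1 hPi.1 hf.1, hcL, hz, hPi.2.2]
    dsimp only
    rw [hf.2, recSign, mul_pow]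
    push_cast
    ring
  have hsumA : ∑ f ∈ monLE Fq x, |cA f| ≤ (x + 1) * s ^ x := by
    rw [Finset.sum_congr rfl fun f _ => abs_sign_mul_tq_pow n f.natDegree, hs]
    exact sum_monLE_tq_le x
  have hsumL : ∑ f ∈ monLE Fq g, |cL f| ≤ 2 * (g + 1) * s ^ g := by
    have h1 : ∀ f ∈ monLE Fq g, |cL f| ≤ 2 * tq Fq ^ f.natDegree := by
      intro f hf
      have h3 := hw _ (mem_monLE.mp hf).2
      rw [hcL]
      dsimp only
      rw [abs_mul, hz, abs_sign_mul_tq_pow, abs_of_nonneg h3.1]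
      exact mul_le_mul_of_nonneg_right h3.2 (pow_nonneg tq_pos.le _)
    refine (Finset.sum_le_sum h1).trans ?_
    rw [← Finset.mul_sum, mul_assoc, hs]
    exact mul_le_mul_of_nonneg_left (sum_monLE_tq_le g) zero_le_two
  have hsumA0 : 0 ≤ ∑ f ∈ monLE Fq x, |cA f| := Finset.sum_nonneg fun _ _ => abs_nonneg _
  have hsumL0 : 0 ≤ ∑ f ∈ monLE Fq g, |cL f| := Finset.sum_nonneg fun _ _ => abs_nonneg _
  set E : ℝ := Bd * (2 * (g + 1) * s ^ g * ((x + 1) * s ^ x) ^ m) with hE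
  set Mx : ℝ := ∑ f ∈ squareTuples Fq (m + 1) x, ∏ i, tq Fq ^ (f i).natDegree with hMx
  set T : Fin (m + 1) → Finset Fq[X] := Fin.cons (monLE Fq g) fun _ => monLE Fq x with hT
  set c : Fin (m + 1) → Fq[X] → ℝ := Fin.cons cL fun _ => cA with hc
  have hxg : x ≤ g := by omega
  have hTmon : ∀ F ∈ Fintype.piFinset T, ∀ i, (F i).Monic := by
    intro F hF i
    rw [Fintype.mem_piFinset] at hF
    have := hF i
    refine Fin.cases ?_ (fun j => ?_) i
    · exact (mem_monLE.mp (hF 0)).1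
    · exact (mem_monLE.mp (hF j.succ)).1
  have hmeanA := abs_sum_prod_sum_sub_le h2 hn hq (k := m + 1) (D := fun _ => x) (by
      rw [Finset.sum_const, Finset.card_univ, Fintype.card_fin, smul_eq_mul, add_mul, one_mul]
      omega) (T := fun _ => monLE Fq x) (fun _ f hf => mem_monLE.mp hf) (fun _ => cA)
  have hmeanL := abs_sum_prod_sum_sub_le h2 hn hq (k := m + 1) (D := Fin.cons g fun _ => x) (by
      rw [Fin.sum_univ_succ]
      simpa using hD) (T := T) (fun i f hf => by
        revert hf
        refine Fin.cases ?_ (fun j => ?_) i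
        · exact fun hf => mem_monLE.mp hf
        · exact fun hf => mem_monLE.mp hf) c
  simp only [Finset.prod_const, Finset.card_univ, Fintype.card_fin] at hmeanA
  simp only [Fin.prod_univ_succ (n := m), hT, hc, Fin.cons_zero, Fin.cons_succ, Finset.prod_const,
    Finset.card_univ, Fintype.card_fin] at hmeanL
  rw [← hT, ← hBd] at hmeanL
  rw [← hBd] at hmeanA
  have hdiagA : ∑ F ∈ (Fintype.piFinset fun _ : Fin (m + 1) => monLE Fq x).filter
      (fun F => IsSquare (∏ i, F i)), ∏ i, cA (F i) = Mx := by
    rw [hMx, squareTuples]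
    refine Finset.sum_congr rfl fun F hF => ?_
    rw [Finset.mem_filter, Fintype.mem_piFinset] at hF
    exact prod_sign_mul_tq_pow (fun i => (mem_monLE.mp (hF.1 i)).1) hF.2
  have hdiagL : Mx ≤ ∑ F ∈ (Fintype.piFinset T).filter
      (fun F => IsSquare (F 0 * ∏ i : Fin m, F i.succ)), cL (F 0) * ∏ i : Fin m, cA (F i.succ) := by
    have hterm : ∀ F ∈ (Fintype.piFinset T).filter
        (fun F => IsSquare (F 0 * ∏ i : Fin m, F i.succ)),
        cL (F 0) * ∏ i : Fin m, cA (F i.succ) =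
          w (F 0).natDegree * ∏ i, tq Fq ^ (F i).natDegree := by
      intro F hF
      rw [Finset.mem_filter, ← Fin.prod_univ_succ] at hF
      rw [← prod_sign_mul_tq_pow (n := n) (hTmon F hF.1) hF.2, Fin.prod_univ_succ, ← mul_assoc]
    rw [Finset.sum_congr rfl hterm]
    have hsub : squareTuples Fq (m + 1) x ⊆ (Fintype.piFinset T).filter
        (fun F => IsSquare (F 0 * ∏ i : Fin m, F i.succ)) := by
      intro F hF
      rw [squareTuples, Finset.mem_filter, Fintype.mem_piFinset] at hF
      rw [Finset.mem_filter, ← Fin.prod_univ_succ, Fintype.mem_piFinset]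
      refine ⟨fun i => ?_, hF.2⟩
      have h := mem_monLE.mp (hF.1 i)
      revert h
      refine Fin.cases ?_ (fun j => ?_) i
      · exact fun h => mem_monLE.mpr ⟨h.1, h.2.trans hxg⟩
      · exact fun h => mem_monLE.mpr h
    have hprod0 : ∀ F : Fin (m + 1) → Fq[X], 0 ≤ ∏ i, tq Fq ^ (F i).natDegree := fun F =>
      Finset.prod_nonneg fun i _ => pow_nonneg tq_pos.le _
    refine le_trans (Finset.sum_le_sum fun F hF => ?_)
      (Finset.sum_le_sum_of_subset_of_nonneg hsub fun F hF _ => ?_)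
    · rw [squareTuples, Finset.mem_filter, Fintype.mem_piFinset] at hF
      refine le_mul_of_one_le_left (hprod0 F) (hw1 _ ?_)
      have := (mem_monLE.mp (hF.1 0)).2
      omega
    · rw [Finset.mem_filter, Fintype.mem_piFinset] at hF
      exact mul_nonneg (hw _ (mem_monLE.mp (hF.1 0)).2).1 (hprod0 F)
  have herrL : Bd * ((∑ f ∈ monLE Fq g, |cL f|) * (∑ f ∈ monLE Fq x, |cA f|) ^ m) ≤ E := by
    rw [hE]
    gcongr
  have herrA : Bd * (∑ f ∈ monLE Fq x, |cA f|) ^ (m + 1) ≤ E := by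
    have h3 : (x + 1) * s ^ x ≤ 2 * (g + 1) * s ^ g := by
      have h4 : (x : ℝ) + 1 ≤ 2 * (g + 1) := by
        have : (x : ℝ) ≤ g := by exact_mod_cast hxg
        linarith
      gcongr
    rw [hE, pow_succ']
    gcongr
    exact hsumA.trans h3
  rw [hdiagA] at hmeanA
  have hπ : (0 : ℝ) ≤ (irrDeg Fq n).card := Nat.cast_nonneg _
  have hlow : ((m + 1 : ℕ) : ℝ) * ∑ P ∈ irrDeg Fq n, LhalfR P * A P ^ m -
      (((m + 1 : ℕ) : ℝ) - 1) * ∑ P ∈ irrDeg Fq n, A P ^ (m + 1) ≤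
      ∑ P ∈ irrDeg Fq n, LhalfR P ^ (m + 1) := by
    rw [Finset.mul_sum, Finset.mul_sum, ← Finset.sum_sub_distrib]
    exact Finset.sum_le_sum fun P _ => even_pow_tangent hk (A P) (LhalfR P)
  rw [Finset.sum_congr rfl fun P hP => by rw [hLP P hP]] at hlow
  have hA' := (abs_le.mp (hmeanA.trans herrA)).2
  have hL' := (abs_le.mp (hmeanL.trans herrL)).1
  have hdL := mul_le_mul_of_nonneg_left hdiagL hπ
  refine le_trans ?_ hlow
  push_cast
  have hm0 : (0 : ℝ) ≤ m := Nat.cast_nonneg m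
  have k1 := mul_le_mul_of_nonneg_left hA' hm0
  have k2 : ((irrDeg Fq n).card : ℝ) * Mx - E ≤ ∑ P ∈ irrDeg Fq n,
      (∑ f ∈ monLE Fq g, cL f * (quadCharP f P : ℝ)) * A P ^ m := by
    linarith
  have k3 := mul_le_mul_of_nonneg_left k2 (by linarith : (0 : ℝ) ≤ m + 1)
  nlinarith

lemma card_pow_le_two_mul_irrDeg {n : ℕ} (hn : 4 ≤ n) :
    Fintype.card Fq ^ n ≤ 2 * n * (irrDeg Fq n).card := by
  have hq : 2 ≤ Fintype.card Fq := Fintype.one_lt_card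
  have h1 := card_pow_le_irrDeg' (Fq := Fq) (n := n) (by omega)
  have h2 : Fintype.card Fq ^ (n / 2) * 2 ^ 2 ≤ Fintype.card Fq ^ n := by
    calc Fintype.card Fq ^ (n / 2) * 2 ^ 2
        ≤ Fintype.card Fq ^ (n / 2) * Fintype.card Fq ^ (n - n / 2) := by
          refine Nat.mul_le_mul_left _ ((Nat.pow_le_pow_left hq 2).trans ?_)
          exact Nat.pow_le_pow_right (by omega) (by omega)
      _ = Fintype.card Fq ^ n := by
          rw [← pow_add]
          congr 1
          omega
  rw [mul_assoc]
  omega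

lemma irrDeg_card_pos {n : ℕ} (hn : 4 ≤ n) : 0 < (irrDeg Fq n).card := by
  rw [Nat.pos_iff_ne_zero]
  intro h0
  have h1 := card_pow_le_two_mul_irrDeg (Fq := Fq) hn
  rw [h0, mul_zero] at h1
  exact absurd h1 (not_le.mpr (Nat.pow_pos Fintype.card_pos))

lemma eventually_const_mul_pow_le {s : ℝ} (hs : 1 < s) (C : ℝ) (K : ℕ) :
    ∀ᶠ j : ℕ in atTop, C * (j : ℝ) ^ K ≤ s ^ j := by
  have h := (tendsto_pow_const_div_const_pow_of_one_lt K hs).const_mul C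
  rw [mul_zero] at h
  filter_upwards [h.eventually_le_const one_pos] with j hj
  rwa [← mul_div_assoc, div_le_one (by positivity)] at hj

lemma one_lt_sqrt_card : 1 < √(Fintype.card Fq : ℝ) := by
  rw [← Real.sqrt_one]
  exact Real.sqrt_lt_sqrt zero_le_one (by exact_mod_cast Fintype.one_lt_card (α := Fq))

lemma eventually_error_le (m : ℕ) : ∀ᶠ n : ℕ in atTop,
    (2 * m + 1 : ℝ) * ((3 * n + 4) * (Fintype.card Fq : ℝ) ^ (n - n / 2) *
      (2 * (((n - 1) / 2 : ℕ) + 1) * √(Fintype.card Fq : ℝ) ^ ((n - 1) / 2) *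
        (((n / (4 * (m + 1)) : ℕ) + 1) * √(Fintype.card Fq : ℝ) ^ (n / (4 * (m + 1)))) ^ m)) ≤
      (irrDeg Fq n).card := by
  obtain ⟨s, hs⟩ : ∃ s, s = √(Fintype.card Fq : ℝ) := ⟨_, rfl⟩
  have hs1 : 1 < s := hs ▸ one_lt_sqrt_card
  have hsq : (Fintype.card Fq : ℝ) = s ^ 2 := by rw [hs, Real.sq_sqrt (Nat.cast_nonneg _)]
  obtain ⟨j₀, hj₀⟩ := eventually_atTop.mp
    (eventually_const_mul_pow_le hs1 (28 * (2 * m + 1) * 12 ^ (m + 3)) (m + 3))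
  filter_upwards [eventually_ge_atTop (4 * j₀ + 8)] with n hn
  rw [← hs, hsq]
  obtain ⟨x, hx⟩ : ∃ x, x = n / (4 * (m + 1)) := ⟨_, rfl⟩
  obtain ⟨g, hg⟩ : ∃ g, g = (n - 1) / 2 := ⟨_, rfl⟩
  obtain ⟨j, hj⟩ : ∃ j, j = n / 4 - 1 := ⟨_, rfl⟩
  have hxm : m * x ≤ n / 4 := by
    rw [hx, ← Nat.div_div_eq_div_mul, mul_comm]
    exact (Nat.mul_le_mul_left _ (Nat.le_succ m)).trans (Nat.div_mul_le_self _ _)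
  rw [← hx, ← hg]
  have hxn : (x : ℝ) + 1 ≤ n := by
    have : x ≤ n / 4 := by
      rw [hx]
      exact Nat.div_le_div_left (by omega) (by omega)
    exact_mod_cast (by omega : x + 1 ≤ n)
  have hgn : (g : ℝ) + 1 ≤ n := by exact_mod_cast (by omega : g + 1 ≤ n)
  have hn4 : (3 * n + 4 : ℝ) ≤ 7 * n := by exact_mod_cast (by omega : 3 * n + 4 ≤ 7 * n)
  have hn12 : (n : ℝ) ≤ 12 * j := by exact_mod_cast (by omega : n ≤ 12 * j)
  have hs0 : (0 : ℝ) < s := by linarith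
  have hn0 : (0 : ℝ) < n := by exact_mod_cast (by omega : 0 < n)
  have hcard : s ^ (2 * n) ≤ 2 * n * (irrDeg Fq n).card := by
    rw [pow_mul, ← hsq]
    exact_mod_cast card_pow_le_two_mul_irrDeg (Fq := Fq) (n := n) (by omega)
  have hmain : 28 * (2 * m + 1) * (n : ℝ) ^ (m + 3) ≤ s ^ j := by
    refine le_trans ?_ (hj₀ j (by omega))
    rw [mul_assoc _ ((12 : ℝ) ^ (m + 3)), ← mul_pow]
    gcongr
  obtain ⟨e, he⟩ : ∃ e, e = 2 * (n - n / 2) + g + x * m := ⟨_, rfl⟩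
  have hexp : e + j ≤ 2 * n := by
    rw [he, mul_comm x m]
    omega
  have h1 : (2 * m + 1 : ℝ) * ((3 * n + 4) * (s ^ 2) ^ (n - n / 2) *
      (2 * (g + 1) * s ^ g * ((x + 1) * s ^ x) ^ m)) ≤
      (2 * m + 1 : ℝ) * ((7 * n) * (s ^ 2) ^ (n - n / 2) *
      (2 * n * s ^ g * (n * s ^ x) ^ m)) := by
    gcongr
  refine h1.trans ?_
  have h2 : (2 * m + 1 : ℝ) * ((7 * n) * (s ^ 2) ^ (n - n / 2) *
      (2 * n * s ^ g * (n * s ^ x) ^ m)) * (2 * n) =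
      28 * (2 * m + 1) * (n : ℝ) ^ (m + 3) * s ^ e := by
    have hse : s ^ e = (s ^ 2) ^ (n - n / 2) * s ^ g * (s ^ x) ^ m := by
      rw [he, pow_add, pow_add, pow_mul, pow_mul]
    rw [hse, mul_pow]
    ring
  have h3 : 28 * (2 * m + 1) * (n : ℝ) ^ (m + 3) * s ^ e ≤ (irrDeg Fq n).card * (2 * n) := by
    calc 28 * (2 * m + 1) * (n : ℝ) ^ (m + 3) * s ^ e ≤ s ^ j * s ^ e := by gcongr
      _ = s ^ (e + j) := by rw [pow_add, mul_comm]
      _ ≤ s ^ (2 * n) := pow_le_pow_right₀ hs1.le hexp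
      _ ≤ _ := hcard.trans (le_of_eq (mul_comm _ _))
  exact le_of_mul_le_mul_right (h2.le.trans h3) (by positivity)

lemma eventually_moment_of_odd_char (h2 : ringChar Fq ≠ 2) {m : ℕ} (hk : Even (m + 1)) :
    ∃ c : ℝ, 0 < c ∧ ∀ᶠ n : ℕ in atTop,
      (irrDeg Fq n).card * (c * (n : ℝ) ^ ((m + 1) * (m + 1 + 1) / 2)) ≤
        ∑ P ∈ irrDeg Fq n, LhalfR P ^ (m + 1) := by
  have hm : 1 ≤ m := by
    rw [Nat.one_le_iff_ne_zero]
    rintro rfl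
    exact absurd hk (by decide)
  obtain ⟨E, hE⟩ : ∃ E, E = (m + 1) * (m + 1 + 1) / 2 := ⟨_, rfl⟩
  have hE1 : 1 ≤ E := by
    rw [hE, Nat.le_div_iff_mul_le two_pos]
    nlinarith
  obtain ⟨B, hB⟩ : ∃ B, B = (Finset.univ.filter
    fun p : OrdPair (m + 1) × OrdPair (m + 1) => p.1 ≠ p.2).card := ⟨_, rfl⟩
  obtain ⟨C₀, hC₀⟩ : ∃ C₀ : ℝ, C₀ = (8 * (m + 1) * E) ^ E * 2 ^ B := ⟨_, rfl⟩
  have hE1' : (0 : ℝ) < E := by exact_mod_cast hE1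
  have hC₀pos : 0 < C₀ := by
    rw [hC₀]
    positivity
  refine ⟨1 / (2 * C₀), by positivity, ?_⟩
  obtain ⟨j₀, hj₀⟩ := eventually_atTop.mp (eventually_const_mul_pow_le
    (s := (Fintype.card Fq : ℝ)) (by exact_mod_cast Fintype.one_lt_card (α := Fq)) 4 1)
  filter_upwards [eventually_error_le (Fq := Fq) m, eventually_ge_atTop (2 * j₀ + 16),
    eventually_ge_atTop ⌈2 * C₀⌉₊] with n herr hn hnC
  have hq : 2 * n ≤ Fintype.card Fq ^ (n - n / 2) := by
    have h1 := hj₀ (n - n / 2) (by omega)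
    rw [pow_one] at h1
    have h3 : 4 * (n - n / 2) ≤ Fintype.card Fq ^ (n - n / 2) := by exact_mod_cast h1
    omega
  obtain ⟨x, hx⟩ : ∃ x, x = n / (4 * (m + 1)) := ⟨_, rfl⟩
  obtain ⟨y, hy⟩ : ∃ y, y = x / (2 * E) := ⟨_, rfl⟩
  have hx8 : x ≤ n / 8 := by
    rw [hx]
    exact Nat.div_le_div_left (by omega) (by omega)
  have hxm : m * x ≤ n / 4 := by
    rw [hx, ← Nat.div_div_eq_div_mul, mul_comm]
    exact (Nat.mul_le_mul_left _ (Nat.le_succ m)).trans (Nat.div_mul_le_self _ _)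
  have hlow := le_sum_LhalfR_pow h2 (n := n) (m := m) (x := x) (by omega) hq (by omega) (by omega) hk
  rw [← hx] at herr
  have hM := le_sum_squareTuples (Fq := Fq) (k := m + 1) (x := x) (y := y) (by
    rw [← hE, hy]
    exact Nat.mul_div_le x (2 * E))
  rw [← hE, ← hB] at hM
  rw [← hE]
  obtain ⟨Mx, hMx⟩ : ∃ Mx, Mx = ∑ f ∈ squareTuples Fq (m + 1) x, ∏ i, tq Fq ^ (f i).natDegree :=
    ⟨_, rfl⟩
  rw [← hMx] at hM hlow
  have hny : (n : ℝ) ≤ 8 * (m + 1) * E * (y + 1) := by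
    have h1 : n < 4 * (m + 1) * (x + 1) := by
      rw [hx]
      exact Nat.lt_mul_div_succ n (by omega)
    have h3 : x < 2 * E * (y + 1) := by
      rw [hy]
      exact Nat.lt_mul_div_succ x (by omega)
    have h4 : n ≤ 8 * (m + 1) * E * (y + 1) := by
      calc n ≤ 4 * (m + 1) * (x + 1) := h1.le
        _ ≤ 4 * (m + 1) * (2 * E * (y + 1)) := Nat.mul_le_mul_left _ h3
        _ = _ := by ring
    exact_mod_cast h4
  have hnE : (n : ℝ) ^ E ≤ C₀ * Mx := by
    calc (n : ℝ) ^ E ≤ (8 * (m + 1) * E * (y + 1)) ^ E := by gcongr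
      _ = (8 * (m + 1) * E) ^ E * (y + 1) ^ E := by rw [mul_pow]
      _ ≤ (8 * (m + 1) * E) ^ E * (2 ^ B * Mx) := by gcongr
      _ = C₀ * Mx := by rw [hC₀]; ring
  have hn1 : 2 * C₀ ≤ (n : ℝ) ^ E := by
    have h1 : 2 * C₀ ≤ n := (Nat.le_ceil _).trans (by exact_mod_cast hnC)
    refine h1.trans (le_self_pow₀ ?_ (by omega))
    exact_mod_cast (by omega : 1 ≤ n)
  have hM1 : 1 / (2 * C₀) * (n : ℝ) ^ E ≤ Mx - 1 := by
    rw [one_div, inv_mul_le_iff₀ (by positivity)]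
    linarith
  have hπ : (0 : ℝ) ≤ (irrDeg Fq n).card := Nat.cast_nonneg _
  have := mul_le_mul_of_nonneg_left hM1 hπ
  linarith

lemma jacobi_eq_one_of_char_two (h2 : ringChar Fq = 2) {P f : Fq[X]} (hP : Irreducible P)
    (hf : f.Monic) (hd : f.natDegree < P.natDegree) : jacobi P f = 1 := by
  rw [jacobi]
  apply Multiset.prod_eq_one
  intro a ha
  obtain ⟨p, hp, rfl⟩ := Multiset.mem_map.mp ha
  have hpi := UniqueFactorizationMonoid.irreducible_of_factor p hp
  have hpf := UniqueFactorizationMonoid.dvd_of_mem_factors hp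
  have hnd : ¬ p ∣ P := fun h => by
    have h1 := natDegree_eq_of_degree_eq (degree_eq_degree_of_associated
      ((hpi.dvd_irreducible_iff_associated hP).mp h))
    have h3 := natDegree_le_of_dvd hpf hf.ne_zero
    omega
  have := Fact.mk hpi
  rw [quadCharP_eq_quadraticChar]
  apply quadraticChar_eq_one_of_char_two
  · rw [← Algebra.ringChar_eq Fq (AdjoinRoot p), h2]
  · rwa [ne_eq, AdjoinRoot.mk_eq_zero]

lemma le_LhalfR_of_char_two (h2 : ringChar Fq = 2) {n : ℕ} {P : Fq[X]}
    (hP : P ∈ irrDeg Fq (n + 1)) : √(Fintype.card Fq : ℝ) ^ n ≤ LhalfR P := by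
  have hPi := mem_irrDeg.mp hP
  have he : (Fintype.card Fq : ℝ) * tq Fq = √(Fintype.card Fq : ℝ) := by
    rw [tq, ← div_eq_mul_inv, Real.div_sqrt]
  rw [LhalfR_eq, hPi.2.2, ← he, mul_pow]
  have h1 : ∀ m ∈ Finset.range (n + 1), (∑ f ∈ monDeg Fq m, (jacobi P f : ℝ)) * tq Fq ^ m =
      (Fintype.card Fq : ℝ) ^ m * tq Fq ^ m := by
    intro m hm
    rw [Finset.mem_range] at hm
    have h3 : ∀ f ∈ monDeg Fq m, (jacobi P f : ℝ) = 1 := fun f hf => by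
      rw [mem_monDeg] at hf
      rw [jacobi_eq_one_of_char_two h2 hPi.2.1 hf.1 (by omega), Int.cast_one]
    rw [Finset.sum_congr rfl h3]
    simp [card_monDeg]
  rw [Finset.sum_congr rfl h1]
  exact Finset.single_le_sum (f := fun m => (Fintype.card Fq : ℝ) ^ m * tq Fq ^ m)
    (fun m _ => mul_nonneg (by positivity) (pow_nonneg tq_pos.le _))
    (Finset.self_mem_range_succ n)

lemma eventually_moment_of_char_two (h2 : ringChar Fq = 2) (m E : ℕ) :
    ∀ᶠ n : ℕ in atTop, (irrDeg Fq n).card * (1 * (n : ℝ) ^ E) ≤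
      ∑ P ∈ irrDeg Fq n, LhalfR P ^ (m + 1) := by
  obtain ⟨j₀, hj₀⟩ := eventually_atTop.mp
    (eventually_const_mul_pow_le (one_lt_sqrt_card (Fq := Fq)) (2 ^ E) E)
  filter_upwards [eventually_ge_atTop (j₀ + 2)] with n hn
  obtain ⟨l, rfl⟩ : ∃ l, n = l + 1 := ⟨n - 1, by omega⟩
  rw [one_mul, ← nsmul_eq_mul, ← Finset.sum_const]
  refine Finset.sum_le_sum fun P hP => ?_
  have h1 := le_LhalfR_of_char_two h2 hP
  have h3 : (1 : ℝ) ≤ √(Fintype.card Fq : ℝ) ^ l := one_le_pow₀ one_lt_sqrt_card.le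
  have h4 : (((l + 1 : ℕ) : ℝ)) ≤ 2 * l := by exact_mod_cast (by omega : l + 1 ≤ 2 * l)
  calc (((l + 1 : ℕ) : ℝ)) ^ E ≤ (2 * l) ^ E := by gcongr
    _ = 2 ^ E * (l : ℝ) ^ E := mul_pow _ _ _
    _ ≤ √(Fintype.card Fq : ℝ) ^ l := hj₀ l (by omega)
    _ ≤ LhalfR P := h1
    _ ≤ LhalfR P ^ (m + 1) := le_self_pow₀ (h3.trans h1) (Nat.succ_ne_zero m)

lemma exists_moment_bound (k : ℕ) (hke : Even k) :
    ∃ c : ℝ, 0 < c ∧ ∀ᶠ n : ℕ in atTop,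
      (irrDeg Fq n).card * (c * (n : ℝ) ^ (k * (k + 1) / 2)) ≤
        ∑ P ∈ irrDeg Fq n, LhalfR P ^ k := by
  rcases k with _ | m
  · exact ⟨1, one_pos, Eventually.of_forall fun n => by simp⟩
  · by_cases h2 : ringChar Fq = 2
    · exact ⟨1, one_pos, eventually_moment_of_char_two h2 m _⟩
    · exact eventually_moment_of_odd_char h2 hke

/-- lower bound for moments over monic irreducibles of degree `n`. -/
theorem prime_moment_lower_bound (k : ℕ) (hke : Even k) :
    ∃ c : ℝ, 0 < c ∧ ∃ N : ℕ, ∀ n : ℕ, N ≤ n →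
      c * (n : ℝ) ^ (k * (k + 1) / 2)
        ≤ (Set.ncard {P : Polynomial Fq | P.Monic ∧ Irreducible P ∧ P.natDegree = n} : ℝ)⁻¹ *
            ∑ᶠ P ∈ {P : Polynomial Fq | P.Monic ∧ Irreducible P ∧ P.natDegree = n},
              LhalfR P ^ k := by
  obtain ⟨c, hc, h⟩ := exists_moment_bound (Fq := Fq) k hke
  obtain ⟨N, hN⟩ := eventually_atTop.mp (h.and (eventually_ge_atTop 4))
  refine ⟨c, hc, N, fun n hn => ?_⟩
  obtain ⟨h1, h4⟩ := hN n hn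
  rw [← coe_irrDeg, Set.ncard_coe_finset, finsum_mem_coe_finset,
    le_inv_mul_iff₀ (by exact_mod_cast irrDeg_card_pos h4)]
  exact h1
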